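/- Let a<b be real, let ψ : ℝ → ]0,+∞[ be a bounded Borel function with ∫_{−∞}^{+∞} ψ(t) dt < +∞ and inf_K ψ > 0 for every compact K ⊂ ℝ, and let {u_k} be a sequence bounded in L¹(]a,b[) with sup_k F₁(u_k) < +∞. Then there exist a subsequence (not relabeled) and a function u ∈ X¹_ψ(]a,b[) such that: u_k ⇀ u weakly* in BV(]a,b[); Ψ₁∘u_k' ⇀ Ψ₁∘(u')^a weakly* in BV(]a,b[); and u_k' → (u')^a pointwise L¹-a.e. in ]a,b[. -/

import Mathlib

open MeasureTheory Filter Set Topology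
open scoped ENNReal NNReal

noncomputable section

/-- `Ψ₁(t) = ∫_{-∞}^t ψ(s) ds`. -/
def Psi1 (ψ : ℝ → ℝ) (t : ℝ) : ℝ := ∫ s in Set.Iic t, ψ s

/-- `Ψ_p(t) = ∫_{-∞}^t ψ(s)^{1/p} ds`. -/
def Psip (ψ : ℝ → ℝ) (p t : ℝ) : ℝ := ∫ s in Set.Iic t, ψ s ^ (1 / p)

/-- The natural extension of `Ψ₁` to the extended reals:
`Ψ₁(-∞) = 0`, `Ψ₁(+∞) = ∫_ℝ ψ`. -/
def Psi1E (ψ : ℝ → ℝ) (t : EReal) : ℝ :=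
  if t = ⊤ then ∫ s, ψ s else if t = ⊥ then 0 else Psi1 ψ t.toReal

/-- Standing assumptions on `ψ` in the case `p = 1`: a bounded, everywhere positive
Borel function, integrable on `ℝ`, whose infimum on every compact set is positive. -/
structure PsiHyp (ψ : ℝ → ℝ) : Prop where
  measurable : Measurable ψ
  pos : ∀ t, 0 < ψ t
  bounded : ∃ C, ∀ t, ψ t ≤ C
  integrable : MeasureTheory.Integrable ψ
  inf_pos : ∀ K : Set ℝ, IsCompact K → ∃ δ > 0, ∀ t ∈ K, δ ≤ ψ t

/-- Standing assumptions on `ψ` in the case `p > 1`: as in `PsiHyp` but with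
`ψ^{1/p}` integrable on `ℝ`. -/
structure PsiHypP (ψ : ℝ → ℝ) (p : ℝ) : Prop where
  measurable : Measurable ψ
  pos : ∀ t, 0 < ψ t
  bounded : ∃ C, ∀ t, ψ t ≤ C
  integrable : MeasureTheory.Integrable fun t => ψ t ^ (1 / p)
  inf_pos : ∀ K : Set ℝ, IsCompact K → ∃ δ > 0, ∀ t ∈ K, δ ≤ ψ t

/-- `(μp, μn)` is the Jordan decomposition of the distributional derivative of
`u ∈ L¹(]a,b[)`; the existence of such a pair encodes `u ∈ BV(]a,b[)`,
and `μp + μn` is the total variation measure `|u'|`. -/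
def IsDerivMeasures (a b : ℝ) (u : ℝ → ℝ) (μp μn : Measure ℝ) : Prop :=
  MeasureTheory.IntegrableOn u (Set.Ioo a b) ∧
  IsFiniteMeasure μp ∧ IsFiniteMeasure μn ∧ μp ⟂ₘ μn ∧
  μp (Set.Ioo a b)ᶜ = 0 ∧ μn (Set.Ioo a b)ᶜ = 0 ∧
  ∀ φ : ℝ → ℝ, ContDiff ℝ 1 φ → tsupport φ ⊆ Set.Ioo a b →
    ∫ x in Set.Ioo a b, u x * deriv φ x = (∫ x, φ x ∂μn) - ∫ x, φ x ∂μp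

/-- The density `(u')^a` of the absolutely continuous part of the derivative whose
Jordan decomposition is `(μp, μn)`. -/
def uaD (μp μn : Measure ℝ) (x : ℝ) : ℝ :=
  (μp.rnDeriv MeasureTheory.volume x).toReal - (μn.rnDeriv MeasureTheory.volume x).toReal

/-- Left approximate limit `u₋(y) = lim_{ε→0⁺} ε⁻¹ ∫_{y-ε}^y u`. -/
def leftApproxLim (u : ℝ → ℝ) (y : ℝ) : ℝ :=
  limUnder (𝓝[>] (0 : ℝ)) fun ε => (∫ x in Set.Ioo (y - ε) y, u x) / ε

/-- Right approximate limit `u₊(y) = lim_{ε→0⁺} ε⁻¹ ∫_y^{y+ε} u`. -/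
def rightApproxLim (u : ℝ → ℝ) (y : ℝ) : ℝ :=
  limUnder (𝓝[>] (0 : ℝ)) fun ε => (∫ x in Set.Ioo y (y + ε), u x) / ε

/-- Left approximate limit computed in the extended reals (may be `±∞`). -/
def leftApproxLimE (u : ℝ → ℝ) (y : ℝ) : EReal :=
  limUnder (𝓝[>] (0 : ℝ)) fun ε => (((∫ x in Set.Ioo (y - ε) y, u x) / ε : ℝ) : EReal)

/-- Right approximate limit computed in the extended reals (may be `±∞`). -/
def rightApproxLimE (u : ℝ → ℝ) (y : ℝ) : EReal :=
  limUnder (𝓝[>] (0 : ℝ)) fun ε => (((∫ x in Set.Ioo y (y + ε), u x) / ε : ℝ) : EReal)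

/-- The jump set `S_u` of `u` in `]a,b[`. -/
def jumpSet (a b : ℝ) (u : ℝ → ℝ) : Set ℝ :=
  {y | y ∈ Set.Ioo a b ∧ leftApproxLim u y ≠ rightApproxLim u y}

/-- `ν_u = sign(u₊ - u₋)`. -/
def jumpSign (u : ℝ → ℝ) (y : ℝ) : ℝ :=
  Real.sign (rightApproxLim u y - leftApproxLim u y)

/-- `Z⁺[w] = {x ∈ ]a,b[ : lim_{ε→0⁺} (2ε)⁻¹∫_{x-ε}^{x+ε} w = +∞}`. -/
def ZPlus (a b : ℝ) (w : ℝ → ℝ) : Set ℝ :=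
  {x | x ∈ Set.Ioo a b ∧
    Tendsto (fun ε => (∫ t in Set.Ioo (x - ε) (x + ε), w t) / (2 * ε)) (𝓝[>] (0 : ℝ)) atTop}

/-- `Z⁻[w] = {x ∈ ]a,b[ : lim_{ε→0⁺} (2ε)⁻¹∫_{x-ε}^{x+ε} w = -∞}`. -/
def ZMinus (a b : ℝ) (w : ℝ → ℝ) : Set ℝ :=
  {x | x ∈ Set.Ioo a b ∧
    Tendsto (fun ε => (∫ t in Set.Ioo (x - ε) (x + ε), w t) / (2 * ε)) (𝓝[>] (0 : ℝ)) atBot}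

/-- The positive part `((u')^c)⁺` of the Cantor part of the derivative of `u`:
the singular part of `μp` with the atoms on the jump set removed. -/
def cantorPos (a b : ℝ) (u : ℝ → ℝ) (μp : Measure ℝ) : Measure ℝ :=
  (μp.singularPart MeasureTheory.volume).restrict (jumpSet a b u)ᶜ

/-- The negative part `((u')^c)⁻` of the Cantor part of the derivative of `u`. -/
def cantorNeg (a b : ℝ) (u : ℝ → ℝ) (μn : Measure ℝ) : Measure ℝ :=
  (μn.singularPart MeasureTheory.volume).restrict (jumpSet a b u)ᶜ

/-- `u ∈ X¹_ψ(]a,b[)`, with derivative data `(μp, μn)`:  `u ∈ BV(]a,b[)`,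
`Ψ₁∘(u')^a ∈ BV(]a,b[)`, and `((u')^c)^±` is concentrated on `Z^±[(u')^a]`. -/
def MemX1 (ψ : ℝ → ℝ) (a b : ℝ) (u : ℝ → ℝ) (μp μn : Measure ℝ) : Prop :=
  IsDerivMeasures a b u μp μn ∧
  (∃ νp νn : Measure ℝ, IsDerivMeasures a b (fun x => Psi1 ψ (uaD μp μn x)) νp νn) ∧
  cantorPos a b u μp (ZPlus a b (uaD μp μn))ᶜ = 0 ∧
  cantorNeg a b u μn (ZMinus a b (uaD μp μn))ᶜ = 0

/-- `f ∈ W^{1,p}(]a,b[)`: `f` has an absolutely continuous representative whose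
pointwise a.e. derivative lies in `L^p(]a,b[)`. -/
def MemW1pOn (p a b : ℝ) (f : ℝ → ℝ) : Prop :=
  ∃ g w : ℝ → ℝ,
    (∀ᵐ x ∂(MeasureTheory.volume.restrict (Set.Ioo a b)), g x = f x) ∧
    MeasureTheory.IntegrableOn w (Set.Ioo a b) ∧
    MeasureTheory.IntegrableOn (fun x => |w x| ^ p) (Set.Ioo a b) ∧
    ∀ x ∈ Set.Ioo a b, ∀ y ∈ Set.Ioo a b, g y - g x = ∫ t in x..y, w t

/-- `u ∈ X^p_ψ(]a,b[)`, with derivative data `(μp, μn)`:  `u ∈ BV(]a,b[)`,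
`Ψ_p∘(u')^a ∈ W^{1,p}(]a,b[)`, and `((u')^s)^±` is concentrated on `Z^±[(u')^a]`. -/
def MemXp (ψ : ℝ → ℝ) (p a b : ℝ) (u : ℝ → ℝ) (μp μn : Measure ℝ) : Prop :=
  IsDerivMeasures a b u μp μn ∧
  MemW1pOn p a b (fun x => Psip ψ p (uaD μp μn x)) ∧
  (μp.singularPart MeasureTheory.volume) (ZPlus a b (uaD μp μn))ᶜ = 0 ∧
  (μn.singularPart MeasureTheory.volume) (ZMinus a b (uaD μp μn))ᶜ = 0

/-- `u ∈ W^{2,p}(]a,b[)` with first derivative `v` and second derivative `w`. -/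
def W2pRep (p a b : ℝ) (u v w : ℝ → ℝ) : Prop :=
  (∀ x ∈ Set.Ioo a b, HasDerivAt u (v x) x) ∧
  (∀ x ∈ Set.Ioo a b, ∀ y ∈ Set.Ioo a b, v y - v x = ∫ t in x..y, w t) ∧
  MeasureTheory.IntegrableOn u (Set.Ioo a b) ∧
  MeasureTheory.IntegrableOn v (Set.Ioo a b) ∧
  MeasureTheory.IntegrableOn w (Set.Ioo a b) ∧
  MeasureTheory.IntegrableOn (fun x => |w x| ^ p) (Set.Ioo a b)

/-- The functional `F_p(u) = ∫_a^b |u'| + ∫_a^b ψ(u')|u''|^p` if `u ∈ W^{2,p}(]a,b[)`,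
`+∞` otherwise (as an infimum over Sobolev representations). -/
def Fp (ψ : ℝ → ℝ) (p a b : ℝ) (u : ℝ → ℝ) : ℝ≥0∞ :=
  ⨅ (v : ℝ → ℝ) (w : ℝ → ℝ) (_ : W2pRep p a b u v w),
    ENNReal.ofReal ((∫ x in Set.Ioo a b, |v x|) + ∫ x in Set.Ioo a b, ψ (v x) * |w x| ^ p)

/-- Strong `L¹(]a,b[)` convergence of a sequence. -/
def TendstoL1 (a b : ℝ) (U : ℕ → ℝ → ℝ) (u : ℝ → ℝ) : Prop :=
  (∀ k, MeasureTheory.IntegrableOn (U k) (Set.Ioo a b)) ∧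
  MeasureTheory.IntegrableOn u (Set.Ioo a b) ∧
  Tendsto (fun k => ∫ x in Set.Ioo a b, |U k x - u x|) atTop (𝓝 0)

/-- The relaxed functional
`F̄_p(u) = inf { liminf_k F_p(u_k) : u_k → u in L¹(]a,b[) }`. -/
def FpRel (ψ : ℝ → ℝ) (p a b : ℝ) (u : ℝ → ℝ) : ℝ≥0∞ :=
  ⨅ (U : ℕ → ℝ → ℝ) (_ : TendstoL1 a b U u),
    liminf (fun k => Fp ψ p a b (U k)) atTop

/-- `Φ(s, t₁, t₂)` of the relaxation formula (`s` being the sign of the jump). -/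
def Phi (ψ : ℝ → ℝ) (s : ℝ) (t₁ t₂ : EReal) : ℝ :=
  if 0 < s then ((∫ t, ψ t) - Psi1E ψ t₁) + ((∫ t, ψ t) - Psi1E ψ t₂)
  else Psi1E ψ t₁ + Psi1E ψ t₂

/-- `Φ̂(s, t₁, t₂)` of Remark 2.5. -/
def PhiHat (ψ : ℝ → ℝ) (s : ℝ) (t₁ t₂ : EReal) : ℝ :=
  if 0 < s then (∫ t, ψ t) - Psi1E ψ (max t₁ t₂)
  else Psi1E ψ (min t₁ t₂)

/-- `ubar` is a `C¹([a,b])` representative of `u`. -/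
def C1Rep (a b : ℝ) (u ubar : ℝ → ℝ) : Prop :=
  (∀ᵐ x ∂(MeasureTheory.volume.restrict (Set.Ioo a b)), ubar x = u x) ∧
  ContDiffOn ℝ 1 ubar (Set.Icc a b)

/-- `u` solves `min { F̄₁(w) + λ ∫_a^b (w - G)² : w ∈ X¹_ψ(]a,b[) }`. -/
def IsSolution1 (ψ : ℝ → ℝ) (a b lam : ℝ) (G u : ℝ → ℝ) : Prop :=
  (∃ μp μn : Measure ℝ, MemX1 ψ a b u μp μn) ∧
  ∀ w : ℝ → ℝ, (∃ ηp ηn : Measure ℝ, MemX1 ψ a b w ηp ηn) →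
    FpRel ψ 1 a b u + ENNReal.ofReal (lam * ∫ x in Set.Ioo a b, (u x - G x) ^ 2) ≤
    FpRel ψ 1 a b w + ENNReal.ofReal (lam * ∫ x in Set.Ioo a b, (w x - G x) ^ 2)

/-- `u` solves `min { F̄_p(w) + λ ∫_a^b |w - G|² : w ∈ X^p_ψ(]a,b[) }`. -/
def IsSolutionP (ψ : ℝ → ℝ) (p a b lam : ℝ) (G u : ℝ → ℝ) : Prop :=
  (∃ μp μn : Measure ℝ, MemXp ψ p a b u μp μn) ∧
  ∀ w : ℝ → ℝ, (∃ ηp ηn : Measure ℝ, MemXp ψ p a b w ηp ηn) →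
    FpRel ψ p a b u + ENNReal.ofReal (lam * ∫ x in Set.Ioo a b, (u x - G x) ^ 2) ≤
    FpRel ψ p a b w + ENNReal.ofReal (lam * ∫ x in Set.Ioo a b, (w x - G x) ^ 2)

/-- The Rudin–Osher–Fatemi energy `|w'|(]a,b[) + λ∫_a^b (w-g)²`, where `(ηp, ηn)`
is the Jordan decomposition of the derivative of `w`. -/
def ROFenergy (a b lam : ℝ) (g w : ℝ → ℝ) (ηp ηn : Measure ℝ) : ℝ≥0∞ :=
  (ηp + ηn) (Set.Ioo a b) + ENNReal.ofReal (lam * ∫ x in Set.Ioo a b, (w x - g x) ^ 2)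

/-- The left-continuous generalized inverse `g^{-1}(c) = inf {x ∈ [a,b] : g(x) ≥ c}`. -/
def gInv (a b : ℝ) (g : ℝ → ℝ) (c : ℝ) : ℝ :=
  sInf {x | x ∈ Set.Icc a b ∧ c ≤ g x}

end

noncomputable section
open MeasureTheory Filter Set Topology
open scoped ENNReal NNReal

section WeakConvergence

/-- A sequence of finite measures of bounded mass carried by a fixed compact set has a weakly
convergent subsequence. -/
lemma exists_subseq_tendsto_finiteMeasure (a b : ℝ) (C : ℝ≥0) (μ : ℕ → FiniteMeasure ℝ)
    (hC : ∀ k, (μ k).mass ≤ C) (hs : ∀ k, (μ k : Measure ℝ) (Icc a b)ᶜ = 0) :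
    ∃ φ : ℕ → ℕ, StrictMono φ ∧ ∃ ν : FiniteMeasure ℝ, Tendsto (fun k => μ (φ k)) atTop (𝓝 ν) := by
  set e : ℝ := (⟨0⟩ : Nonempty ℝ).some
  set K : Set ℝ := Icc (min a e) (max b e)
  have hnorm : ∀ k, (μ k).normalize ∈
      {p : ProbabilityMeasure ℝ | ∀ n : ℕ, p ((fun _ : ℕ => K) n)ᶜ ≤ (fun _ : ℕ => (0 : ℝ≥0)) n} := by
    intro k n
    have hsub : Kᶜ ⊆ (Icc a b)ᶜ := compl_subset_compl.2
      (Icc_subset_Icc (min_le_left _ _) (le_max_left _ _))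
    suffices h : ((μ k).normalize : Measure ℝ) Kᶜ = 0 by
      simp [ProbabilityMeasure.coeFn_def, h]
    by_cases h0 : μ k = 0
    · have h1 : ((0 : FiniteMeasure ℝ).normalize : Measure ℝ) = Measure.dirac e :=
        congrArg Subtype.val (dif_pos FiniteMeasure.zero_mass)
      rw [h0, h1, Measure.dirac_apply' _ measurableSet_Icc.compl]
      simp
    · rw [FiniteMeasure.toMeasure_normalize_eq_of_nonzero _ h0, Measure.smul_apply,
        measure_mono_null hsub (hs k), smul_zero]
  have hcomp := isCompact_setOfPred_probabilityMeasure_mass_eq_compl_isCompact_le (E := ℝ)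
    (u := fun _ => 0) (K := fun _ => K) tendsto_const_nhds (fun _ => isCompact_Icc)
    (Or.inl inferInstance)
  obtain ⟨p, -, φ₁, hφ₁, hp⟩ := hcomp.tendsto_subseq hnorm
  obtain ⟨m, -, φ₂, hφ₂, hm⟩ := (isCompact_Icc (a := (0 : ℝ≥0)) (b := C)).tendsto_subseq
    (x := fun k => (μ (φ₁ k)).mass) (fun k => ⟨zero_le, hC _⟩)
  refine ⟨φ₁ ∘ φ₂, hφ₁.comp hφ₂, m • p.toFiniteMeasure, ?_⟩
  rw [FiniteMeasure.tendsto_iff_forall_testAgainstNN_tendsto]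
  intro f
  have hp' := hp.comp hφ₂.tendsto_atTop
  rw [ProbabilityMeasure.tendsto_nhds_iff_toFiniteMeasure_tendsto_nhds,
    FiniteMeasure.tendsto_iff_forall_testAgainstNN_tendsto] at hp'
  have := hm.mul (hp' f)
  rw [FiniteMeasure.smul_testAgainstNN_apply]
  refine this.congr fun k => ?_
  exact (FiniteMeasure.testAgainstNN_eq_mass_mul (μ (φ₁ (φ₂ k))) f).symm

variable {μ : ℕ → FiniteMeasure ℝ} {ν : FiniteMeasure ℝ}

lemma eventually_measure_lt_of_isClosed (h : Tendsto μ atTop (𝓝 ν)) {F : Set ℝ} (hF : IsClosed F)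
    {c : ℝ≥0∞} (hc : (ν : Measure ℝ) F < c) : ∀ᶠ k in atTop, (μ k : Measure ℝ) F < c :=
  eventually_lt_of_limsup_lt
    ((FiniteMeasure.limsup_measure_closed_le_of_tendsto h hF).trans_lt hc)

lemma eventually_lt_measure_of_isOpen (h : Tendsto μ atTop (𝓝 ν)) {O : Set ℝ} (hO : IsOpen O)
    {c : ℝ≥0∞} (hc : c < (ν : Measure ℝ) O) : ∀ᶠ k in atTop, c < (μ k : Measure ℝ) O := by
  have hmass : Tendsto (fun k => (μ k : Measure ℝ) univ) atTop (𝓝 ((ν : Measure ℝ) univ)) := by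
    simpa only [← FiniteMeasure.ennreal_mass] using ENNReal.tendsto_coe.2 h.mass
  have hadd : ∀ m : FiniteMeasure ℝ,
      (m : Measure ℝ) O + (m : Measure ℝ) Oᶜ = (m : Measure ℝ) univ :=
    fun m => measure_add_measure_compl hO.measurableSet
  obtain ⟨d, hcd, hd⟩ := exists_between hc
  have hdt : d ≠ ∞ := hd.ne_top
  have h1 : (ν : Measure ℝ) Oᶜ + d < (ν : Measure ℝ) univ := by
    rw [← hadd ν, add_comm]
    exact ENNReal.add_lt_add_right (measure_ne_top _ _) hd
  have h2 : (ν : Measure ℝ) Oᶜ < (ν : Measure ℝ) Oᶜ + (d - c) :=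
    ENNReal.lt_add_right (measure_ne_top _ _) (tsub_pos_of_lt hcd).ne'
  filter_upwards [eventually_measure_lt_of_isClosed h hO.isClosed_compl h2,
    hmass.eventually_const_lt h1] with k hk1 hk2
  rw [← hadd (μ k)] at hk2
  by_contra hcon
  rw [not_lt] at hcon
  have : (μ k : Measure ℝ) O + (μ k : Measure ℝ) Oᶜ ≤ c + ((ν : Measure ℝ) Oᶜ + (d - c)) :=
    add_le_add hcon hk1.le
  rw [add_left_comm, add_tsub_cancel_of_le hcd.le] at this
  exact absurd (hk2.trans_le this) (lt_irrefl _)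

lemma measure_le_of_eventually_le_of_isOpen (h : Tendsto μ atTop (𝓝 ν)) {O : Set ℝ}
    (hO : IsOpen O) {c : ℝ≥0∞} (hc : ∀ᶠ k in atTop, (μ k : Measure ℝ) O ≤ c) :
    (ν : Measure ℝ) O ≤ c := by
  by_contra hcon
  rw [not_le] at hcon
  obtain ⟨k, hk1, hk2⟩ := (hc.and (eventually_lt_measure_of_isOpen h hO hcon)).exists
  exact absurd hk1 (not_le.2 hk2)

/-- Convergence of the distribution functions at the non-atoms of the weak limit. -/
lemma tendsto_measureReal_Iic (h : Tendsto μ atTop (𝓝 ν)) {x : ℝ} (hx : (ν : Measure ℝ) {x} = 0) :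
    Tendsto (fun k => (μ k : Measure ℝ).real (Iic x)) atTop (𝓝 ((ν : Measure ℝ).real (Iic x))) := by
  refine (ENNReal.tendsto_toReal (measure_ne_top _ _)).comp (tendsto_order.2 ⟨fun c hc => ?_,
    fun c hc => eventually_measure_lt_of_isClosed h isClosed_Iic hc⟩)
  have hI : (ν : Measure ℝ) (Iic x) = (ν : Measure ℝ) (Iio x) := by
    refine le_antisymm ?_ (measure_mono Iio_subset_Iic_self)
    rw [← Iio_union_right]
    exact (measure_union_le _ _).trans (by simp [hx])
  rw [hI] at hc
  exact (eventually_lt_measure_of_isOpen h isOpen_Iio hc).mono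
    fun k hk => hk.trans_le (measure_mono Iio_subset_Iic_self)

/-- If the measures are eventually bounded by a multiple of Lebesgue measure on an open set, then
the weak limit is absolutely continuous there. -/
lemma measure_eq_zero_of_eventually_le_mul_volume (h : Tendsto μ atTop (𝓝 ν)) {J : Set ℝ}
    (hJ : IsOpen J) (R : ℝ≥0)
    (hR : ∀ᶠ k in atTop, ∀ s ⊆ J, MeasurableSet s → (μ k : Measure ℝ) s ≤ R * volume s)
    {A : Set ℝ} (hA : volume A = 0) : (ν : Measure ℝ) (A ∩ J) = 0 := by
  refine le_antisymm (ENNReal.le_of_forall_pos_le_add fun ε hε _ => ?_) zero_le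
  obtain ⟨O, hAO, hO, hOv⟩ := A.exists_isOpen_lt_of_lt (μ := volume) ((ε : ℝ≥0∞) / (R + 1))
    (by rw [hA]; exact ENNReal.div_pos (by exact_mod_cast hε.ne') (by finiteness))
  have : (ν : Measure ℝ) (O ∩ J) ≤ ε := by
    refine measure_le_of_eventually_le_of_isOpen h (hO.inter hJ) ?_
    filter_upwards [hR] with k hk
    refine (hk _ inter_subset_right (hO.inter hJ).measurableSet).trans ?_
    calc (R : ℝ≥0∞) * volume (O ∩ J) ≤ (R + 1) * (ε / (R + 1)) := by
          gcongr
          · exact le_self_add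
          · exact (measure_mono inter_subset_left).trans hOv.le
      _ ≤ ε := ENNReal.mul_div_le
  simpa using (measure_mono (inter_subset_inter_left J hAO)).trans this

end WeakConvergence

section PartMeasure

/-- The measure `g⁺ · L¹⌊S`. -/
def posPartMeasure (S : Set ℝ) (g : ℝ → ℝ) : Measure ℝ :=
  (volume.restrict S).withDensity fun x => ENNReal.ofReal (g x)

lemma isFiniteMeasure_posPartMeasure {S : Set ℝ} {g : ℝ → ℝ} (hg : IntegrableOn g S) :
    IsFiniteMeasure (posPartMeasure S g) :=
  isFiniteMeasure_withDensity_ofReal hg.2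

lemma integral_posPartMeasure {S : Set ℝ} {g : ℝ → ℝ} (hg : IntegrableOn g S) (h : ℝ → ℝ) :
    ∫ x, h x ∂(posPartMeasure S g) = ∫ x in S, h x * max (g x) 0 := by
  rw [posPartMeasure, integral_withDensity_eq_integral_toReal_smul₀
    hg.aemeasurable.ennreal_ofReal (by simp)]
  simp only [ENNReal.toReal_ofReal', smul_eq_mul, mul_comm]

lemma integrable_mul_max {S : Set ℝ} {g h : ℝ → ℝ} (hg : IntegrableOn g S)
    (hh : AEStronglyMeasurable h (volume.restrict S)) {C : ℝ} (hC : ∀ x, |h x| ≤ C) :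
    IntegrableOn (fun x => h x * max (g x) 0) S :=
  Integrable.bdd_mul (Integrable.pos_part hg) hh (ae_of_all _ fun x => by simpa using hC x)

lemma integral_posPartMeasure_sub {S : Set ℝ} {g h : ℝ → ℝ} (hg : IntegrableOn g S)
    (hh : AEStronglyMeasurable h (volume.restrict S)) {C : ℝ} (hC : ∀ x, |h x| ≤ C) :
    ∫ x, h x ∂(posPartMeasure S g) - ∫ x, h x ∂(posPartMeasure S fun x => -g x) =
      ∫ x in S, h x * g x := by
  rw [integral_posPartMeasure hg, integral_posPartMeasure (g := fun x => -g x) hg.neg,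
    ← integral_sub (integrable_mul_max hg hh hC)
      (integrable_mul_max (g := fun x => -g x) hg.neg hh hC)]
  refine integral_congr_ae (ae_of_all _ fun x => ?_)
  have : max (g x) 0 - max (-g x) 0 = g x := max_zero_sub_max_neg_zero_eq_self _
  simp only [← mul_sub, this]

lemma posPartMeasure_apply {S s : Set ℝ} {g : ℝ → ℝ} (hs : MeasurableSet s) :
    posPartMeasure S g s = ∫⁻ x in s ∩ S, ENNReal.ofReal (g x) := by
  rw [posPartMeasure, withDensity_apply _ hs, Measure.restrict_restrict hs]

lemma measureReal_posPartMeasure_univ_le {S : Set ℝ} {g : ℝ → ℝ} (hg : IntegrableOn g S) :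
    (posPartMeasure S g).real univ ≤ ∫ x in S, |g x| := by
  rw [Measure.real, posPartMeasure_apply MeasurableSet.univ, univ_inter,
    integral_eq_lintegral_of_nonneg_ae (ae_of_all _ fun x => abs_nonneg _)
      hg.aestronglyMeasurable.norm]
  refine ENNReal.toReal_mono ?_ (lintegral_mono fun x => ENNReal.ofReal_le_ofReal (le_abs_self _))
  have := hg.abs.2
  rw [hasFiniteIntegral_iff_ofReal (ae_of_all _ fun x => abs_nonneg _)] at this
  exact this.ne

lemma measureReal_posPartMeasure_sub {S s : Set ℝ} {g : ℝ → ℝ} (hg : IntegrableOn g S)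
    (hs : MeasurableSet s) :
    (posPartMeasure S g).real s - (posPartMeasure S fun x => -g x).real s =
      ∫ x in s ∩ S, g x := by
  have := integral_posPartMeasure_sub (h := s.indicator 1) hg
    ((stronglyMeasurable_one.indicator hs).aestronglyMeasurable) (C := 1)
    (fun x => by by_cases hx : x ∈ s <;> simp [hx])
  rw [integral_indicator_one hs, integral_indicator_one hs] at this
  rw [this, ← Measure.restrict_restrict hs, ← integral_indicator hs]
  refine integral_congr_ae (ae_of_all _ fun x => ?_)
  by_cases hx : x ∈ s <;> simp [hx]

end PartMeasure

section ChainRule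

lemma AbsolutelyContinuousOnInterval.lipschitz_comp {F f : ℝ → ℝ} {p q : ℝ} {K : ℝ≥0}
    (hF : LipschitzWith K F) (hf : AbsolutelyContinuousOnInterval f p q) :
    AbsolutelyContinuousOnInterval (F ∘ f) p q := by
  rw [absolutelyContinuousOnInterval_iff] at hf ⊢
  intro ε hε
  obtain ⟨δ, hδ, h⟩ := hf (ε / (K + 1)) (by positivity)
  refine ⟨δ, hδ, fun E hE hE' => ?_⟩
  have h1 := h E hE hE'
  calc ∑ i ∈ Finset.range E.1, dist ((F ∘ f) (E.2 i).1) ((F ∘ f) (E.2 i).2)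
      ≤ ∑ i ∈ Finset.range E.1, K * dist (f (E.2 i).1) (f (E.2 i).2) :=
        Finset.sum_le_sum fun i _ => hF.dist_le_mul _ _
    _ = K * ∑ i ∈ Finset.range E.1, dist (f (E.2 i).1) (f (E.2 i).2) := by
        rw [Finset.mul_sum]
    _ ≤ (K + 1) * ∑ i ∈ Finset.range E.1, dist (f (E.2 i).1) (f (E.2 i).2) := by
        gcongr
        linarith
    _ < (K + 1) * (ε / (K + 1)) := by gcongr
    _ = ε := by field_simp

lemma integral_comp_primitive_mul_of_continuous {w f : ℝ → ℝ} {p q c : ℝ}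
    (hw : IntervalIntegrable w volume p q) (hf : Continuous f) {C : ℝ} (hC : ∀ x, |f x| ≤ C) :
    ∫ t in p..q, f (c + ∫ s in p..t, w s) * w t =
      ∫ s in c..(c + ∫ s in p..q, w s), f s := by
  set F : ℝ → ℝ := fun t => ∫ s in c..t, f s
  have hFd : ∀ t, HasDerivAt F (f t) t := fun t => hf.integral_hasStrictDerivAt c t |>.hasDerivAt
  have hFl : LipschitzWith C.toNNReal F := by
    refine lipschitzWith_of_nnnorm_deriv_le (fun t => (hFd t).differentiableAt) fun t => ?_
    rw [(hFd t).deriv, ← NNReal.coe_le_coe, coe_nnnorm, Real.norm_eq_abs]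
    exact (hC t).trans (Real.le_coe_toNNReal C)
  set V : ℝ → ℝ := fun t => c + ∫ s in p..t, w s with hV
  have hVac : AbsolutelyContinuousOnInterval V p q := by
    have h1 : AbsolutelyContinuousOnInterval (fun _ : ℝ => c) p q :=
      (LipschitzWith.const c).lipschitzOnWith.absolutelyContinuousOnInterval
    exact h1.add (hw.absolutelyContinuousOnInterval_intervalIntegral left_mem_uIcc)
  have h := (hVac.lipschitz_comp hFl).integral_deriv_eq_sub
  have h0 : F (V p) = 0 := by simp [F, V]
  rw [Function.comp_apply, Function.comp_apply, h0, sub_zero] at h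
  refine Eq.trans ?_ h
  refine intervalIntegral.integral_congr_ae ?_
  filter_upwards [hw.ae_hasDerivAt_integral] with t ht htm
  have h2 : HasDerivAt V (w t) t :=
    (ht (uIoc_subset_uIcc htm) p left_mem_uIcc).const_add c
  exact ((hFd (V t)).comp t h2).deriv.symm

/-- Change of variables along an absolutely continuous function, for bounded Borel integrands. -/
lemma integral_comp_primitive_mul {w f : ℝ → ℝ} {p q c : ℝ} (hpq : p ≤ q)
    (hw : IntegrableOn w (Ioc p q)) (hf : Measurable f) {C : ℝ} (hC : ∀ x, |f x| ≤ C) :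
    ∫ t in Ioc p q, f (c + ∫ s in p..t, w s) * w t =
      ∫ s in c..(c + ∫ s in p..q, w s), f s := by
  have hwi : IntervalIntegrable w volume p q := (intervalIntegrable_iff_integrableOn_Ioc_of_le hpq).2 hw
  set V : ℝ → ℝ := fun t => c + ∫ s in p..t, w s with hV
  have hVm : AEMeasurable V (volume.restrict (Ioc p q)) := by
    have : ContinuousOn V (Icc p q) := by
      have := intervalIntegral.continuousOn_primitive_interval
        ((integrableOn_Icc_iff_integrableOn_Ioc (μ := volume)).2 hw |> fun h => by
          rwa [← uIcc_of_le hpq] at h)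
      rw [uIcc_of_le hpq] at this
      exact continuousOn_const.add this
    exact (this.mono Ioc_subset_Icc_self).aemeasurable measurableSet_Ioc
  have hac : ∀ g : ℝ → ℝ, posPartMeasure (Ioc p q) g ≪ volume.restrict (Ioc p q) :=
    fun g => withDensity_absolutelyContinuous _ _
  set m₁ := (posPartMeasure (Ioc p q) w).map V with hm₁
  set m₂ := (posPartMeasure (Ioc p q) fun x => -w x).map V with hm₂
  set A := volume.restrict (Ioc c (V q)) with hA
  set B := volume.restrict (Ioc (V q) c) with hB
  have := isFiniteMeasure_posPartMeasure hw
  have := isFiniteMeasure_posPartMeasure (g := fun x => -w x) hw.neg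
  have key : ∀ g : ℝ → ℝ, Measurable g → (∃ D, ∀ x, |g x| ≤ D) →
      ∫ x, g x ∂m₁ - ∫ x, g x ∂m₂ = ∫ t in Ioc p q, g (V t) * w t := by
    rintro g hg ⟨D, hD⟩
    rw [hm₁, hm₂, integral_map (hVm.mono_ac (hac _)) hg.aestronglyMeasurable,
      integral_map (hVm.mono_ac (hac _)) hg.aestronglyMeasurable]
    exact integral_posPartMeasure_sub (h := fun t => g (V t)) hw
      (hg.comp_aemeasurable hVm).aestronglyMeasurable (fun x => hD _)
  have hint : ∀ (m : Measure ℝ) [IsFiniteMeasure m] (g : ℝ → ℝ), Measurable g →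
      (∃ D, ∀ x, |g x| ≤ D) → Integrable g m := by
    rintro m _ g hg ⟨D, hD⟩
    exact Integrable.of_bound hg.aestronglyMeasurable D (ae_of_all _ hD)
  have hmeas : m₁ + B = m₂ + A := by
    refine ext_of_forall_integral_eq_of_IsFiniteMeasure fun g => ?_
    have hgm : Measurable g := g.continuous.measurable
    have hgb : ∃ D, ∀ x, |g x| ≤ D := ⟨‖g‖, fun x => g.norm_coe_le_norm x⟩
    rw [integral_add_measure (hint _ _ hgm hgb) (hint _ _ hgm hgb),
      integral_add_measure (hint _ _ hgm hgb) (hint _ _ hgm hgb)]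
    have h1 := key g hgm hgb
    obtain ⟨D, hD⟩ := hgb
    have h2 := integral_comp_primitive_mul_of_continuous (c := c) hwi g.continuous hD
    rw [intervalIntegral.integral_of_le hpq] at h2
    change ∫ t in Ioc p q, g (V t) * w t = (∫ x, g x ∂A) - ∫ x, g x ∂B at h2
    linarith
  have h3 := congrArg (fun m => ∫ x, f x ∂m) hmeas
  beta_reduce at h3
  rw [integral_add_measure (hint _ _ hf ⟨C, hC⟩) (hint _ _ hf ⟨C, hC⟩),
    integral_add_measure (hint _ _ hf ⟨C, hC⟩) (hint _ _ hf ⟨C, hC⟩)] at h3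
  have h4 := key f hf ⟨C, hC⟩
  rw [← h4]
  change _ = (∫ x, f x ∂A) - ∫ x, f x ∂B
  linarith

end ChainRule

section JordanPair

variable {α β μp μn : Measure ℝ}

lemma exists_mutuallySingular_add_eq_add (α β : Measure ℝ) [IsFiniteMeasure α]
    [IsFiniteMeasure β] : ∃ μp μn : Measure ℝ, IsFiniteMeasure μp ∧ IsFiniteMeasure μn ∧
      μp ⟂ₘ μn ∧ μp + β = μn + α := by
  set j := (α.toSignedMeasure - β.toSignedMeasure).toJordanDecomposition with hj
  have hfp : IsFiniteMeasure j.posPart := j.posPart_finite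
  have hfn : IsFiniteMeasure j.negPart := j.negPart_finite
  refine ⟨j.posPart, j.negPart, hfp, hfn, j.mutuallySingular, ?_⟩
  have h1 : j.posPart.toSignedMeasure - j.negPart.toSignedMeasure =
      α.toSignedMeasure - β.toSignedMeasure :=
    SignedMeasure.toSignedMeasure_toJordanDecomposition _
  have h2 : j.posPart.toSignedMeasure + β.toSignedMeasure =
      j.negPart.toSignedMeasure + α.toSignedMeasure := by
    rw [add_comm j.negPart.toSignedMeasure]
    exact sub_eq_sub_iff_add_eq_add.1 h1
  rw [← Measure.toSignedMeasure_add, ← Measure.toSignedMeasure_add] at h2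
  exact Measure.toSignedMeasure_eq_toSignedMeasure_iff.1 h2

lemma le_of_mutuallySingular_add_eq_add (hs : μp ⟂ₘ μn) (h : μp + β = μn + α) : μp ≤ α := by
  obtain ⟨S, hS, hSp, hSn⟩ := hs
  refine Measure.le_iff.2 fun A hA => ?_
  have h1 : μp A ≤ μp (A ∩ Sᶜ) := by
    calc μp A ≤ μp (A ∩ S) + μp (A ∩ Sᶜ) := by
          conv_lhs => rw [← inter_union_compl A S]
          exact measure_union_le _ _
      _ = μp (A ∩ Sᶜ) := by rw [measure_mono_null inter_subset_right hSp, zero_add]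
  have h2 := congrArg (fun m : Measure ℝ => m (A ∩ Sᶜ)) h
  simp only [Measure.add_apply, measure_mono_null inter_subset_right hSn, zero_add] at h2
  calc μp A ≤ μp (A ∩ Sᶜ) + β (A ∩ Sᶜ) := h1.trans le_self_add
    _ = α (A ∩ Sᶜ) := h2
    _ ≤ α A := measure_mono inter_subset_left

lemma integral_sub_eq_of_add_eq_add {f : ℝ → ℝ} (h : μp + β = μn + α) (h1 : Integrable f μp)
    (h2 : Integrable f μn) (h3 : Integrable f α) (h4 : Integrable f β) :
    ∫ x, f x ∂μp - ∫ x, f x ∂μn = ∫ x, f x ∂α - ∫ x, f x ∂β := by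
  have h5 := congrArg (fun m => ∫ x, f x ∂m) h
  beta_reduce at h5
  rw [integral_add_measure h1 h4, integral_add_measure h2 h3] at h5
  linarith

end JordanPair

section DistributionFunction

lemma hasCompactSupport_of_tsupport_subset_Ioo {f : ℝ → ℝ} {a b : ℝ}
    (h : tsupport f ⊆ Ioo a b) : HasCompactSupport f :=
  isCompact_Icc.of_isClosed_subset (isClosed_tsupport f) (h.trans Ioo_subset_Icc_self)

lemma eq_zero_of_tsupport_subset {f : ℝ → ℝ} {S : Set ℝ} (h : tsupport f ⊆ S) {x : ℝ}
    (hx : x ∉ S) : f x = 0 :=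
  image_eq_zero_of_notMem_tsupport fun hx' => hx (h hx')

lemma integral_restrict_of_tsupport_subset {f : ℝ → ℝ} {S : Set ℝ} (h : tsupport f ⊆ S)
    (μ : Measure ℝ) : ∫ x in S, f x ∂μ = ∫ x, f x ∂μ :=
  setIntegral_eq_integral_of_forall_compl_eq_zero fun _ hx => eq_zero_of_tsupport_subset h hx

lemma monotone_measureReal_Iic (μ : Measure ℝ) [IsFiniteMeasure μ] :
    Monotone fun x => μ.real (Iic x) :=
  fun _ _ hxy => measureReal_mono (Iic_subset_Iic.2 hxy)

lemma integrableOn_measureReal_Iic (μ : Measure ℝ) [IsFiniteMeasure μ] (a b : ℝ) :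
    IntegrableOn (fun x => μ.real (Iic x)) (Ioo a b) :=
  Measure.integrableOn_of_bounded (M := μ.real univ) (by simp)
    (monotone_measureReal_Iic μ).measurable.aestronglyMeasurable
    (ae_of_all _ fun x => by
      rw [Real.norm_of_nonneg measureReal_nonneg]
      exact measureReal_mono (subset_univ _))

lemma integral_measureReal_Iic_mul_deriv (μ : Measure ℝ) [IsFiniteMeasure μ] {φ : ℝ → ℝ}
    (hφ : ContDiff ℝ 1 φ) (hc : HasCompactSupport φ) :
    ∫ x, μ.real (Iic x) * deriv φ x = -∫ x, φ x ∂μ := by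
  have hd : Integrable (deriv φ) :=
    (hφ.continuous_deriv le_rfl).integrable_of_hasCompactSupport hc.deriv
  have hms : MeasurableSet {z : ℝ × ℝ | z.2 ≤ z.1} := measurableSet_le measurable_snd measurable_fst
  have hi : Integrable (Function.uncurry fun x y : ℝ =>
      (Iic x).indicator (fun _ => deriv φ x) y) (volume.prod μ) := by
    have := (hd.comp_fst μ).indicator hms
    refine this.congr (ae_of_all _ fun z => ?_)
    simp [indicator, Function.uncurry]
  have h1 : ∀ x, μ.real (Iic x) * deriv φ x = ∫ y, (Iic x).indicator (fun _ => deriv φ x) y ∂μ := by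
    intro x
    rw [integral_indicator measurableSet_Iic, setIntegral_const, smul_eq_mul]
  simp_rw [h1]
  rw [integral_integral_swap hi, ← integral_neg]
  refine integral_congr_ae (ae_of_all _ fun y => ?_)
  have h2 : ∀ x, (Iic x).indicator (fun _ => deriv φ x) y = (Ici y).indicator (deriv φ) x := by
    intro x
    simp [indicator]
  simp only [h2]
  rw [integral_indicator measurableSet_Ici, integral_Ici_eq_integral_Ioi,
    hc.integral_Ioi_deriv_eq hφ]

lemma isDerivMeasures_of_ae_eq_cdf {a b d : ℝ} {U : ℝ → ℝ} {α β μp μn : Measure ℝ}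
    [IsFiniteMeasure α] [IsFiniteMeasure β] [IsFiniteMeasure μp] [IsFiniteMeasure μn]
    (hU : ∀ᵐ x ∂(volume.restrict (Ioo a b)), U x = d + α.real (Iic x) - β.real (Iic x))
    (hs : μp ⟂ₘ μn) (h : μp + β.restrict (Ioo a b) = μn + α.restrict (Ioo a b)) :
    IsDerivMeasures a b U μp μn := by
  have hα := integrableOn_measureReal_Iic α a b
  have hβ := integrableOn_measureReal_Iic β a b
  have hd : IntegrableOn (fun _ : ℝ => d) (Ioo a b) := integrableOn_const (by simp)
  refine ⟨(((hd.add hα).sub hβ).congr (hU.mono fun x hx => hx.symm)), inferInstance, inferInstance,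
    hs, ?_, ?_, fun φ hφ hsupp => ?_⟩
  · refine le_antisymm ((le_of_mutuallySingular_add_eq_add hs h _).trans ?_) zero_le
    simp
  · refine le_antisymm ((le_of_mutuallySingular_add_eq_add hs.symm h.symm _).trans ?_) zero_le
    simp
  have hc := hasCompactSupport_of_tsupport_subset_Ioo hsupp
  have hint : ∀ (m : Measure ℝ) [IsFiniteMeasure m], Integrable φ m := fun m _ =>
    hφ.continuous.integrable_of_hasCompactSupport hc
  have hdi : Integrable (deriv φ) :=
    (hφ.continuous_deriv le_rfl).integrable_of_hasCompactSupport hc.deriv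
  have hds : tsupport (deriv φ) ⊆ Ioo a b := fun x hx => hsupp (tsupport_deriv_subset hx)
  have hb : ∀ (m : Measure ℝ) [IsFiniteMeasure m],
      Integrable (fun x => m.real (Iic x) * deriv φ x) := by
    intro m _
    refine hdi.bdd_mul (c := m.real univ)
      (monotone_measureReal_Iic m).measurable.aestronglyMeasurable (ae_of_all _ fun x => ?_)
    rw [Real.norm_of_nonneg measureReal_nonneg]
    exact measureReal_mono (subset_univ _)
  have e1 : ∫ x in Ioo a b, U x * deriv φ x =
      ∫ x, (d + α.real (Iic x) - β.real (Iic x)) * deriv φ x := by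
    rw [← integral_restrict_of_tsupport_subset
      (f := fun x => (d + α.real (Iic x) - β.real (Iic x)) * deriv φ x)
      ((tsupport_mul_subset_right).trans hds)]
    exact integral_congr_ae (hU.mono fun x hx => by simp only [hx])
  have e0 : ∫ x, deriv φ x = 0 := by
    rw [← intervalIntegral.integral_Iic_add_Ioi (b := 0) hdi.integrableOn hdi.integrableOn,
      hc.integral_Ioi_deriv_eq hφ, hc.integral_Iic_deriv_eq hφ, add_neg_cancel]
  have e2 : ∫ x, (d + α.real (Iic x) - β.real (Iic x)) * deriv φ x =
      -(∫ x, φ x ∂α - ∫ x, φ x ∂β) := by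
    simp_rw [sub_mul, add_mul]
    have hdα : Integrable (fun x => d * deriv φ x + α.real (Iic x) * deriv φ x) :=
      (hdi.const_mul d).add (hb α)
    rw [integral_sub hdα (hb β), integral_add (hdi.const_mul d) (hb α),
      integral_const_mul, e0, integral_measureReal_Iic_mul_deriv α hφ hc,
      integral_measureReal_Iic_mul_deriv β hφ hc]
    ring
  have e3 := integral_sub_eq_of_add_eq_add h (hint _) (hint _) (hint _) (hint _)
  rw [integral_restrict_of_tsupport_subset hsupp, integral_restrict_of_tsupport_subset hsupp] at e3
  rw [e1, e2, ← e3]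
  ring

lemma tendsto_measureReal_Iic_nhdsGT (μ : Measure ℝ) [IsFiniteMeasure μ] (y : ℝ) :
    Tendsto (fun x => μ.real (Iic x)) (𝓝[>] y) (𝓝 (μ.real (Iic y))) := by
  have h := tendsto_measure_biInter_gt (μ := μ) (s := fun x : ℝ => Iic x) (a := y)
    (fun r _ => measurableSet_Iic.nullMeasurableSet)
    (fun i j _ hij => Iic_subset_Iic.2 hij) ⟨y + 1, by simp, measure_ne_top _ _⟩
  have e : ⋂ r > y, Iic r = Iic y := by
    ext z
    simp only [mem_iInter, mem_Iic]
    exact ⟨fun hz => le_of_forall_gt_imp_ge_of_dense hz, fun hz r hr => hz.trans (le_of_lt hr)⟩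
  rw [e] at h
  exact (ENNReal.tendsto_toReal (measure_ne_top _ _)).comp h

lemma tendsto_measureReal_Iic_nhdsLT (μ : Measure ℝ) [IsFiniteMeasure μ] (y : ℝ) :
    Tendsto (fun x => μ.real (Iic x)) (𝓝[<] y) (𝓝 (μ.real (Iic y) - μ.real {y})) := by
  have h := tendsto_measure_biInter_gt (μ := μ) (s := fun t : ℝ => Ioc (y - t) y) (a := 0)
    (fun r _ => measurableSet_Ioc.nullMeasurableSet)
    (fun i j _ hij => Ioc_subset_Ioc_left (by linarith)) ⟨1, by simp, measure_ne_top _ _⟩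
  have e : ⋂ r > (0 : ℝ), Ioc (y - r) y = {y} := by
    ext z
    simp only [mem_iInter, mem_Ioc, mem_singleton_iff]
    constructor
    · intro hz
      refine le_antisymm (hz 1 one_pos).2 (le_of_forall_pos_le_add fun r hr => ?_)
      linarith [(hz r hr).1]
    · rintro rfl r hr
      exact ⟨by linarith, le_rfl⟩
  rw [e] at h
  have h1 : Tendsto (fun x => y - x) (𝓝[<] y) (𝓝[>] 0) := by
    refine tendsto_nhdsWithin_iff.2 ⟨?_, ?_⟩
    · have : Tendsto (fun x => y - x) (𝓝 y) (𝓝 (y - y)) := tendsto_const_nhds.sub tendsto_id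
      rw [sub_self] at this
      exact this.mono_left nhdsWithin_le_nhds
    · filter_upwards [self_mem_nhdsWithin] with x hx
      have hxy : x < y := hx
      exact mem_Ioi.2 (sub_pos.2 hxy)
  have h2 := ((ENNReal.tendsto_toReal (measure_ne_top _ _)).comp h).comp h1
  refine (tendsto_const_nhds.sub h2).congr' ?_
  filter_upwards [self_mem_nhdsWithin] with x hx
  have hx' : x < y := hx
  simp only [Function.comp_apply, sub_sub_cancel]
  have := measureReal_union (μ := μ) (s₁ := Iic x) (s₂ := Ioc x y)
    (Set.disjoint_left.2 fun z hz hz' => absurd hz'.1 (not_lt.2 hz)) measurableSet_Ioc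
  rw [Iic_union_Ioc_eq_Iic hx'.le] at this
  rw [this]
  simp [Measure.real]

lemma rightApproxLim_eq_of_tendsto {U : ℝ → ℝ} {a b y l : ℝ} (hy : y ∈ Ioo a b)
    (hi : IntegrableOn U (Ioo a b)) (h : Tendsto U (𝓝[>] y) (𝓝 l)) : rightApproxLim U y = l := by
  refine Tendsto.limUnder_eq (Metric.tendsto_nhds.2 fun δ hδ => ?_)
  obtain ⟨z, hz, hzU⟩ := (mem_nhdsGT_iff_exists_Ioo_subset).1
    (Metric.tendsto_nhds.1 h (δ / 2) (by positivity))
  have hm : 0 < min (z - y) (b - y) := lt_min (sub_pos.2 hz) (sub_pos.2 hy.2)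
  filter_upwards [Ioo_mem_nhdsGT hm] with ε hε
  have hε1 : y + ε ≤ z := by linarith [hε.2.le.trans (min_le_left _ _)]
  have hε2 : y + ε ≤ b := by linarith [hε.2.le.trans (min_le_right _ _)]
  have hiU : IntegrableOn U (Ioo y (y + ε)) := hi.mono_set (Ioo_subset_Ioo hy.1.le hε2)
  have hb := norm_setIntegral_le_of_norm_le_const (μ := volume) (s := Ioo y (y + ε))
    (f := fun x => U x - l) (C := δ / 2) (by simp) fun x hx => by
      have := hzU ⟨hx.1, hx.2.trans_le hε1⟩
      rw [mem_ofPred, Real.dist_eq] at this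
      exact this.le
  rw [integral_sub hiU (integrableOn_const (by simp)), setIntegral_const] at hb
  simp only [Real.volume_real_Ioo_of_le (by linarith [hε.1] : y ≤ y + ε), add_sub_cancel_left,
    smul_eq_mul, Real.norm_eq_abs] at hb
  rw [Real.dist_eq]
  have hε0 := hε.1
  have : (∫ x in Ioo y (y + ε), U x) / ε - l = ((∫ x in Ioo y (y + ε), U x) - ε * l) / ε := by
    field_simp
  rw [this, abs_div, abs_of_pos hε0, div_lt_iff₀ hε0]
  nlinarith

lemma leftApproxLim_eq_of_tendsto {U : ℝ → ℝ} {a b y l : ℝ} (hy : y ∈ Ioo a b)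
    (hi : IntegrableOn U (Ioo a b)) (h : Tendsto U (𝓝[<] y) (𝓝 l)) : leftApproxLim U y = l := by
  refine Tendsto.limUnder_eq (Metric.tendsto_nhds.2 fun δ hδ => ?_)
  obtain ⟨z, hz, hzU⟩ := (mem_nhdsLT_iff_exists_Ioo_subset).1
    (Metric.tendsto_nhds.1 h (δ / 2) (by positivity))
  have hm : 0 < min (y - z) (y - a) := lt_min (sub_pos.2 hz) (sub_pos.2 hy.1)
  filter_upwards [Ioo_mem_nhdsGT hm] with ε hε
  have hε1 : z ≤ y - ε := by linarith [hε.2.le.trans (min_le_left _ _)]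
  have hε2 : a ≤ y - ε := by linarith [hε.2.le.trans (min_le_right _ _)]
  have hiU : IntegrableOn U (Ioo (y - ε) y) := hi.mono_set (Ioo_subset_Ioo hε2 hy.2.le)
  have hb := norm_setIntegral_le_of_norm_le_const (μ := volume) (s := Ioo (y - ε) y)
    (f := fun x => U x - l) (C := δ / 2) (by simp) fun x hx => by
      have := hzU ⟨hε1.trans_lt hx.1, hx.2⟩
      rw [mem_ofPred, Real.dist_eq] at this
      exact this.le
  rw [integral_sub hiU (integrableOn_const (by simp)), setIntegral_const] at hb
  simp only [Real.volume_real_Ioo_of_le (by linarith [hε.1] : y - ε ≤ y), sub_sub_cancel,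
    smul_eq_mul, Real.norm_eq_abs] at hb
  rw [Real.dist_eq]
  have hε0 := hε.1
  have : (∫ x in Ioo (y - ε) y, U x) / ε - l = ((∫ x in Ioo (y - ε) y, U x) - ε * l) / ε := by
    field_simp
  rw [this, abs_div, abs_of_pos hε0, div_lt_iff₀ hε0]
  nlinarith

/-- The jump set of a difference of distribution functions consists of the points at which the
two measures have different atoms. -/
lemma mem_jumpSet_iff_measureReal_singleton_ne {a b d y : ℝ} {α β : Measure ℝ}
    [IsFiniteMeasure α] [IsFiniteMeasure β] :
    y ∈ jumpSet a b (fun x => d + α.real (Iic x) - β.real (Iic x)) ↔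
      y ∈ Ioo a b ∧ α.real {y} ≠ β.real {y} := by
  refine and_congr_right fun hy => ?_
  have hi : IntegrableOn (fun x => d + α.real (Iic x) - β.real (Iic x)) (Ioo a b) :=
    ((integrableOn_const (by simp)).add (integrableOn_measureReal_Iic α a b)).sub
      (integrableOn_measureReal_Iic β a b)
  rw [rightApproxLim_eq_of_tendsto hy hi
      ((tendsto_const_nhds.add (tendsto_measureReal_Iic_nhdsGT α y)).sub
        (tendsto_measureReal_Iic_nhdsGT β y)),
    leftApproxLim_eq_of_tendsto hy hi
      ((tendsto_const_nhds.add (tendsto_measureReal_Iic_nhdsLT α y)).sub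
        (tendsto_measureReal_Iic_nhdsLT β y)), not_iff_not]
  constructor <;> intro h <;> linarith

end DistributionFunction

section Extraction

/-- The finite measure whose density is the positive part of an integrable function. -/
def posPartFiniteMeasure {S : Set ℝ} {g : ℝ → ℝ} (hg : IntegrableOn g S) : FiniteMeasure ℝ :=
  ⟨posPartMeasure S g, isFiniteMeasure_posPartMeasure hg⟩

@[simp]
lemma coe_posPartFiniteMeasure {S : Set ℝ} {g : ℝ → ℝ} (hg : IntegrableOn g S) :
    (posPartFiniteMeasure hg : Measure ℝ) = posPartMeasure S g := rfl

lemma countable_setOf_measure_singleton_ne_zero (μ : Measure ℝ) [IsFiniteMeasure μ] :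
    {x | μ {x} ≠ 0}.Countable := by
  have := Measure.countable_meas_pos_of_disjoint_iUnion (μ := μ) (As := fun x : ℝ => {x})
    (fun x => measurableSet_singleton x) (fun x y hxy => by simpa using hxy)
  simpa only [pos_iff_ne_zero] using this

lemma exists_subseq_tendsto_posPartFiniteMeasure {a b C : ℝ} {g : ℕ → ℝ → ℝ}
    (hg : ∀ k, IntegrableOn (g k) (Ioo a b)) (hC : ∀ k, ∫ x in Ioo a b, |g k x| ≤ C) :
    ∃ φ : ℕ → ℕ, StrictMono φ ∧ ∃ ν : FiniteMeasure ℝ,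
      Tendsto (fun k => posPartFiniteMeasure (hg (φ k))) atTop (𝓝 ν) := by
  have hC0 : 0 ≤ C := (setIntegral_nonneg measurableSet_Ioo fun x _ => abs_nonneg _).trans (hC 0)
  refine exists_subseq_tendsto_finiteMeasure a b ⟨C, hC0⟩ (fun k => posPartFiniteMeasure (hg k))
    (fun k => ?_) (fun k => ?_)
  · exact NNReal.coe_le_coe.1 ((measureReal_posPartMeasure_univ_le (hg k)).trans (hC k))
  · rw [coe_posPartFiniteMeasure, posPartMeasure_apply measurableSet_Icc.compl]
    have : (Icc a b)ᶜ ∩ Ioo a b = ∅ :=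
      (disjoint_compl_left.mono_right Ioo_subset_Icc_self).inter_eq
    simp [this]

lemma measureReal_Iic_posPartMeasure_sub {a b x : ℝ} {g : ℝ → ℝ} (hg : IntegrableOn g (Ioo a b))
    (hx : x ∈ Ioo a b) :
    (posPartMeasure (Ioo a b) g).real (Iic x) -
      (posPartMeasure (Ioo a b) fun x => -g x).real (Iic x) = ∫ t in a..x, g t := by
  rw [measureReal_posPartMeasure_sub hg measurableSet_Iic, intervalIntegral.integral_of_le hx.1.le]
  congr 2
  ext t
  exact ⟨fun h => ⟨h.2.1, h.1⟩, fun h => ⟨h.2, h.1, lt_of_le_of_lt h.2 hx.2⟩⟩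

/-- Helly-type extraction: a sequence of absolutely continuous functions bounded in `W^{1,1}`
has a subsequence converging in `L¹` and at all but countably many points, the limit being the
difference of the distribution functions of the weak limits of the derivatives. -/
lemma exists_subseq_tendsto_of_primitive {a b C₀ C : ℝ} (hab : a < b) {G g : ℕ → ℝ → ℝ}
    (hG : ∀ k, IntegrableOn (G k) (Ioo a b)) (hg : ∀ k, IntegrableOn (g k) (Ioo a b))
    (hGg : ∀ k, ∀ x ∈ Ioo a b, ∀ y ∈ Ioo a b, G k y - G k x = ∫ t in x..y, g k t)
    (hC₀ : ∀ k, ∫ x in Ioo a b, |G k x| ≤ C₀) (hC : ∀ k, ∫ x in Ioo a b, |g k x| ≤ C) :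
    ∃ φ : ℕ → ℕ, StrictMono φ ∧ ∃ (α β : FiniteMeasure ℝ) (d : ℝ),
      Tendsto (fun k => posPartFiniteMeasure (hg (φ k))) atTop (𝓝 α) ∧
      Tendsto (fun k => posPartFiniteMeasure (g := fun x => -g (φ k) x) (hg (φ k)).neg) atTop
        (𝓝 β) ∧
      (∀ x ∈ Ioo a b, (α : Measure ℝ) {x} = 0 → (β : Measure ℝ) {x} = 0 →
        Tendsto (fun k => G (φ k) x) atTop
          (𝓝 (d + (α : Measure ℝ).real (Iic x) - (β : Measure ℝ).real (Iic x)))) ∧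
      Tendsto (fun k => ∫ x in Ioo a b, |G (φ k) x -
        (d + (α : Measure ℝ).real (Iic x) - (β : Measure ℝ).real (Iic x))|) atTop (𝓝 0) := by
  obtain ⟨φ₁, hφ₁, α, hα⟩ := exists_subseq_tendsto_posPartFiniteMeasure hg hC
  obtain ⟨φ₂, hφ₂, β, hβ⟩ := exists_subseq_tendsto_posPartFiniteMeasure
    (g := fun k x => -g (φ₁ k) x) (fun k => (hg (φ₁ k)).neg) (C := C)
    (fun k => by simpa only [abs_neg] using hC (φ₁ k))
  obtain ⟨x₀, hx₀⟩ := nonempty_Ioo.2 hab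
  set D : ℕ → ℝ := fun k => G k x₀ - ∫ t in a..x₀, g k t with hD
  have hii : ∀ k, ∀ x ∈ Ioo a b, IntervalIntegrable (g k) volume a x := fun k x hx =>
    (intervalIntegrable_iff_integrableOn_Ioc_of_le hx.1.le).2
      ((hg k).mono_set fun t ht => ⟨ht.1, ht.2.trans_lt hx.2⟩)
  have hGD : ∀ k, ∀ x ∈ Ioo a b, G k x = D k + ∫ t in a..x, g k t := by
    intro k x hx
    have h1 := hGg k x₀ hx₀ x hx
    have h2 := intervalIntegral.integral_interval_sub_left (hii k x hx) (hii k x₀ hx₀)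
    simp only [hD]
    linarith
  have hgC : ∀ k, ∀ x ∈ Ioo a b, |∫ t in a..x, g k t| ≤ C := by
    intro k x hx
    rw [intervalIntegral.integral_of_le hx.1.le]
    refine (abs_integral_le_integral_abs).trans (le_trans ?_ (hC k))
    exact setIntegral_mono_set (hg k).abs (ae_of_all _ fun _ => abs_nonneg _)
      (ae_of_all _ fun t (ht : t ∈ Ioc a x) => ⟨ht.1, ht.2.trans_lt hx.2⟩)
  have hDb : ∀ k, |D k| ≤ (C₀ + C * (b - a)) / (b - a) := by
    intro k
    have hba : 0 < b - a := sub_pos.2 hab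
    rw [le_div_iff₀ hba]
    have hv : volume.real (Ioo a b) = b - a := Real.volume_real_Ioo_of_le hab.le
    calc |D k| * (b - a) = ∫ _ in Ioo a b, |D k| := by
          rw [setIntegral_const, hv, smul_eq_mul, mul_comm]
      _ ≤ ∫ x in Ioo a b, (|G k x| + C) := by
          refine setIntegral_mono_on (integrableOn_const (by simp))
            ((hG k).abs.add (integrableOn_const (by simp))) measurableSet_Ioo fun x hx => ?_
          have h1 := hGD k x hx
          have h2 : D k = G k x - ∫ t in a..x, g k t := by linarith
          rw [h2]
          exact (abs_sub _ _).trans (add_le_add le_rfl (hgC k x hx))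
      _ ≤ C₀ + C * (b - a) := by
          rw [integral_add (hG k).abs (integrableOn_const (by simp)), setIntegral_const, hv,
            smul_eq_mul, mul_comm C]
          exact add_le_add (hC₀ k) le_rfl
  obtain ⟨d, -, φ₃, hφ₃, hd⟩ := isCompact_Icc.tendsto_subseq
    (x := fun k => D (φ₁ (φ₂ k))) (fun k => abs_le.1 (hDb (φ₁ (φ₂ k))))
  have hα' : Tendsto (fun k => posPartFiniteMeasure (hg (φ₁ (φ₂ (φ₃ k))))) atTop (𝓝 α) :=
    hα.comp (hφ₂.comp hφ₃).tendsto_atTop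
  have hβ' : Tendsto (fun k => posPartFiniteMeasure (g := fun x => -g (φ₁ (φ₂ (φ₃ k))) x)
      (hg (φ₁ (φ₂ (φ₃ k)))).neg) atTop (𝓝 β) := hβ.comp hφ₃.tendsto_atTop
  have hlim : ∀ x ∈ Ioo a b, (α : Measure ℝ) {x} = 0 → (β : Measure ℝ) {x} = 0 →
      Tendsto (fun k => G (φ₁ (φ₂ (φ₃ k))) x) atTop
        (𝓝 (d + (α : Measure ℝ).real (Iic x) - (β : Measure ℝ).real (Iic x))) := by
    intro x hx hxα hxβ
    refine ((hd.add (tendsto_measureReal_Iic hα' hxα)).sub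
      (tendsto_measureReal_Iic hβ' hxβ)).congr fun k => ?_
    rw [hGD _ x hx, ← measureReal_Iic_posPartMeasure_sub (hg _) hx]
    simp only [Function.comp_apply, coe_posPartFiniteMeasure]
    ring
  refine ⟨fun k => φ₁ (φ₂ (φ₃ k)), (hφ₁.comp hφ₂).comp hφ₃, α, β, d, hα', hβ', hlim, ?_⟩
  set H : ℝ → ℝ := fun x => d + (α : Measure ℝ).real (Iic x) - (β : Measure ℝ).real (Iic x)
  have hH : IntegrableOn H (Ioo a b) :=
    ((integrableOn_const (by simp)).add (integrableOn_measureReal_Iic _ a b)).sub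
      (integrableOn_measureReal_Iic _ a b)
  have hcount : ∀ᵐ x ∂(volume.restrict (Ioo a b)),
      (α : Measure ℝ) {x} = 0 ∧ (β : Measure ℝ) {x} = 0 := by
    filter_upwards [(countable_setOf_measure_singleton_ne_zero (α : Measure ℝ)).ae_notMem
      (volume.restrict (Ioo a b)), (countable_setOf_measure_singleton_ne_zero
      (β : Measure ℝ)).ae_notMem (volume.restrict (Ioo a b))] with x h1 h2
    exact ⟨not_not.1 h1, not_not.1 h2⟩
  have key := tendsto_integral_of_dominated_convergence (μ := volume.restrict (Ioo a b))
    (F := fun k x => |G (φ₁ (φ₂ (φ₃ k))) x - H x|) (f := fun _ => 0)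
    (fun x => ((C₀ + C * (b - a)) / (b - a) + C) + |H x|)
    (fun k => ((hG _).sub hH).aestronglyMeasurable.norm)
    ((integrableOn_const (by simp)).add hH.abs)
    (fun k => by
      filter_upwards [ae_restrict_mem measurableSet_Ioo] with x hx
      rw [Real.norm_eq_abs, abs_abs]
      refine (abs_sub _ _).trans (add_le_add ?_ le_rfl)
      rw [hGD _ x hx]
      exact (abs_add_le _ _).trans (add_le_add (hDb _) (hgC _ x hx)))
    (by
      filter_upwards [ae_restrict_mem measurableSet_Ioo, hcount] with x hx hx2
      have := ((hlim x hx hx2.1 hx2.2).sub_const (H x)).abs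
      simpa [H] using this)
  rw [integral_zero] at key
  exact key

end Extraction

section Psi1

variable {ψ : ℝ → ℝ}

lemma PsiHyp.Psi1_sub (hψ : PsiHyp ψ) (x y : ℝ) : Psi1 ψ y - Psi1 ψ x = ∫ t in x..y, ψ t :=
  intervalIntegral.integral_Iic_sub_Iic hψ.integrable.integrableOn hψ.integrable.integrableOn

lemma PsiHyp.strictMono_Psi1 (hψ : PsiHyp ψ) : StrictMono (Psi1 ψ) := by
  intro x y hxy
  have := intervalIntegral.intervalIntegral_pos_of_pos
    (hψ.integrable.intervalIntegrable (a := x) (b := y)) hψ.pos hxy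
  rw [← hψ.Psi1_sub] at this
  linarith

lemma PsiHyp.continuous_Psi1 (hψ : PsiHyp ψ) : Continuous (Psi1 ψ) := by
  have h : Psi1 ψ = fun y => Psi1 ψ 0 + ∫ t in (0 : ℝ)..y, ψ t := by
    funext y
    rw [← hψ.Psi1_sub]
    ring
  rw [h]
  exact continuous_const.add (intervalIntegral.continuous_primitive
    (fun _ _ => hψ.integrable.intervalIntegrable) 0)

lemma PsiHyp.Psi1_pos (hψ : PsiHyp ψ) (x : ℝ) : 0 < Psi1 ψ x := by
  have h1 : 0 ≤ Psi1 ψ (x - 1) := setIntegral_nonneg measurableSet_Iic fun t _ => (hψ.pos t).le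
  exact h1.trans_lt (hψ.strictMono_Psi1 (by linarith))

lemma PsiHyp.Psi1_lt (hψ : PsiHyp ψ) (x : ℝ) : Psi1 ψ x < ∫ t, ψ t := by
  have h1 : Psi1 ψ (x + 1) ≤ ∫ t, ψ t :=
    setIntegral_le_integral hψ.integrable (ae_of_all _ fun t => (hψ.pos t).le)
  exact (hψ.strictMono_Psi1 (by linarith)).trans_le h1

lemma PsiHyp.tendsto_Psi1_atTop (hψ : PsiHyp ψ) : Tendsto (Psi1 ψ) atTop (𝓝 (∫ t, ψ t)) :=
  (aecover_Iic tendsto_id).integral_tendsto_of_countably_generated hψ.integrable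

lemma PsiHyp.tendsto_Psi1_atBot (hψ : PsiHyp ψ) : Tendsto (Psi1 ψ) atBot (𝓝 0) := by
  have h1 : Tendsto (fun x => ∫ t in Ioi x, ψ t) atBot (𝓝 (∫ t, ψ t)) :=
    (aecover_Ioi tendsto_id).integral_tendsto_of_countably_generated hψ.integrable
  have h2 := (tendsto_const_nhds (x := ∫ t, ψ t)).sub h1
  rw [sub_self] at h2
  refine h2.congr fun x => ?_
  rw [← intervalIntegral.integral_Iic_add_Ioi (b := x) hψ.integrable.integrableOn
    hψ.integrable.integrableOn]
  simp [Psi1]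

/-- The range of `Ψ₁` is the open interval between its limits. -/
lemma PsiHyp.exists_Psi1_eq (hψ : PsiHyp ψ) {s : ℝ} (h0 : 0 < s) (h1 : s < ∫ t, ψ t) :
    ∃ t, Psi1 ψ t = s := by
  obtain ⟨p, hp⟩ := (hψ.tendsto_Psi1_atBot.eventually_lt_const h0).exists
  obtain ⟨q, hq⟩ := (hψ.tendsto_Psi1_atTop.eventually_const_lt h1).exists
  exact mem_range_of_exists_le_of_exists_ge hψ.continuous_Psi1 ⟨p, hp.le⟩ ⟨q, hq.le⟩

lemma PsiHyp.tendsto_of_tendsto_Psi1 (hψ : PsiHyp ψ) {v : ℕ → ℝ} {t : ℝ}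
    (h : Tendsto (fun k => Psi1 ψ (v k)) atTop (𝓝 (Psi1 ψ t))) : Tendsto v atTop (𝓝 t) := by
  refine tendsto_order.2 ⟨fun c hc => ?_, fun c hc => ?_⟩
  · filter_upwards [h.eventually_const_lt (hψ.strictMono_Psi1 hc)] with k hk
    exact hψ.strictMono_Psi1.lt_iff_lt.1 hk
  · filter_upwards [h.eventually_lt_const (hψ.strictMono_Psi1 hc)] with k hk
    exact hψ.strictMono_Psi1.lt_iff_lt.1 hk

lemma PsiHyp.tendsto_atTop_of_tendsto_Psi1 (hψ : PsiHyp ψ) {v : ℕ → ℝ}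
    (h : Tendsto (fun k => Psi1 ψ (v k)) atTop (𝓝 (∫ t, ψ t))) : Tendsto v atTop atTop := by
  refine tendsto_atTop.2 fun R => ?_
  filter_upwards [h.eventually_const_lt (hψ.Psi1_lt R)] with k hk
  exact (hψ.strictMono_Psi1.lt_iff_lt.1 hk).le

lemma PsiHyp.tendsto_atBot_of_tendsto_Psi1 (hψ : PsiHyp ψ) {v : ℕ → ℝ}
    (h : Tendsto (fun k => Psi1 ψ (v k)) atTop (𝓝 0)) : Tendsto v atTop atBot := by
  refine tendsto_atBot.2 fun R => ?_
  filter_upwards [h.eventually_lt_const (hψ.Psi1_pos R)] with k hk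
  exact (hψ.strictMono_Psi1.lt_iff_lt.1 hk).le

lemma PsiHyp.exists_abs_le (hψ : PsiHyp ψ) : ∃ C, ∀ t, |ψ t| ≤ C := by
  obtain ⟨C, hC⟩ := hψ.bounded
  exact ⟨C, fun t => by rw [abs_of_pos (hψ.pos t)]; exact hC t⟩

lemma continuousOn_of_sub_eq_integral {a b : ℝ} {v w : ℝ → ℝ} (hw : IntegrableOn w (Ioo a b))
    (h : ∀ x ∈ Ioo a b, ∀ y ∈ Ioo a b, v y - v x = ∫ t in x..y, w t) :
    ContinuousOn v (Ioo a b) := by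
  rcases (Ioo a b).eq_empty_or_nonempty with he | ⟨x₀, hx₀⟩
  · simp [he]
  have h1 : ContinuousOn (fun y => ∫ t in a..y, w t) (Icc a b) := by
    have := intervalIntegral.continuousOn_primitive_interval (μ := volume) (f := w) (a := a)
      (b := b) ?_
    · rwa [uIcc_of_le (hx₀.1.trans hx₀.2).le] at this
    · rwa [uIcc_of_le (hx₀.1.trans hx₀.2).le, integrableOn_Icc_iff_integrableOn_Ioo]
  have h2 : ContinuousOn (fun y => v x₀ + ((∫ t in a..y, w t) - ∫ t in a..x₀, w t)) (Ioo a b) :=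
    continuousOn_const.add ((h1.mono Ioo_subset_Icc_self).sub continuousOn_const)
  refine h2.congr fun y hy => ?_
  have hii : ∀ x ∈ Ioo a b, IntervalIntegrable w volume a x := fun x hx =>
    (intervalIntegrable_iff_integrableOn_Ioc_of_le hx.1.le).2
      (hw.mono_set fun t ht => ⟨ht.1, ht.2.trans_lt hx.2⟩)
  simp only [intervalIntegral.integral_interval_sub_left (hii y hy) (hii x₀ hx₀), ← h x₀ hx₀ y hy]
  ring

lemma PsiHyp.integrableOn_comp_mul (hψ : PsiHyp ψ) {a b : ℝ} {v w : ℝ → ℝ}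
    (hv : ContinuousOn v (Ioo a b)) (hw : IntegrableOn w (Ioo a b)) :
    IntegrableOn (fun x => ψ (v x) * w x) (Ioo a b) := by
  obtain ⟨C, hC⟩ := hψ.exists_abs_le
  exact hw.bdd_mul (c := C) (hψ.measurable.comp_aemeasurable
    (hv.aemeasurable measurableSet_Ioo)).aestronglyMeasurable (ae_of_all _ fun x => hC _)

/-- Chain rule for `Ψ₁ ∘ v` with `v` absolutely continuous. -/
lemma PsiHyp.Psi1_comp_sub (hψ : PsiHyp ψ) {a b : ℝ} {v w : ℝ → ℝ}
    (hw : IntegrableOn w (Ioo a b))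
    (h : ∀ x ∈ Ioo a b, ∀ y ∈ Ioo a b, v y - v x = ∫ t in x..y, w t) :
    ∀ x ∈ Ioo a b, ∀ y ∈ Ioo a b,
      Psi1 ψ (v y) - Psi1 ψ (v x) = ∫ t in x..y, ψ (v t) * w t := by
  have key : ∀ x ∈ Ioo a b, ∀ y ∈ Ioo a b, x ≤ y →
      Psi1 ψ (v y) - Psi1 ψ (v x) = ∫ t in x..y, ψ (v t) * w t := by
    intro x hx y hy hxy
    obtain ⟨C, hC⟩ := hψ.exists_abs_le
    have hsub : Ioc x y ⊆ Ioo a b := fun t ht => ⟨hx.1.trans ht.1, ht.2.trans_lt hy.2⟩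
    have h1 := integral_comp_primitive_mul (c := v x) hxy (hw.mono_set hsub) hψ.measurable hC
    have h2 : ∀ t ∈ Ioo a b, v x + ∫ s in x..t, w s = v t := fun t ht => by
      rw [← h x hx t ht]
      ring
    rw [h2 y hy] at h1
    rw [hψ.Psi1_sub, ← h1, intervalIntegral.integral_of_le hxy]
    exact setIntegral_congr_fun measurableSet_Ioc fun t ht => by
      simp only [h2 t (hsub ht)]
  intro x hx y hy
  rcases le_total x y with hxy | hxy
  · exact key x hx y hy hxy
  · rw [intervalIntegral.integral_symm, ← key y hy x hx hxy]
    ring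

end Psi1

section LocalLimits

variable {a b : ℝ} {g : ℕ → ℝ → ℝ} {α β : FiniteMeasure ℝ}

lemma exists_abs_le_of_continuous_of_hasCompactSupport {f : ℝ → ℝ} (hf : Continuous f)
    (hc : HasCompactSupport f) : ∃ C, ∀ x, |f x| ≤ C := by
  obtain ⟨C, hC⟩ := hc.exists_bound_of_continuous hf
  exact ⟨C, hC⟩

/-- The functions `g k`, seen as measures, converge weakly* to the signed measure with Jordan
decomposition `(μp, μn)`. -/
lemma tendsto_integral_mul_of_tendsto_posPart (hg : ∀ k, IntegrableOn (g k) (Ioo a b))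
    (hα : Tendsto (fun k => posPartFiniteMeasure (hg k)) atTop (𝓝 α))
    (hβ : Tendsto (fun k => posPartFiniteMeasure (g := fun x => -g k x) (hg k).neg) atTop (𝓝 β))
    {μp μn : Measure ℝ} [IsFiniteMeasure μp] [IsFiniteMeasure μn]
    (h : μp + (β : Measure ℝ).restrict (Ioo a b) = μn + (α : Measure ℝ).restrict (Ioo a b))
    {f : ℝ → ℝ} (hf : Continuous f) (hs : tsupport f ⊆ Ioo a b) :
    Tendsto (fun k => ∫ x in Ioo a b, f x * g k x) atTop
      (𝓝 ((∫ x, f x ∂μp) - ∫ x, f x ∂μn)) := by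
  have hc := hasCompactSupport_of_tsupport_subset_Ioo hs
  have hint : ∀ (m : Measure ℝ) [IsFiniteMeasure m], Integrable f m := fun m _ =>
    hf.integrable_of_hasCompactSupport hc
  obtain ⟨C, hC⟩ := exists_abs_le_of_continuous_of_hasCompactSupport hf hc
  set F : BoundedContinuousFunction ℝ ℝ := BoundedContinuousFunction.ofNormedAddCommGroup f hf C hC
  have h1 := FiniteMeasure.tendsto_iff_forall_integral_tendsto.1 hα F
  have h2 := FiniteMeasure.tendsto_iff_forall_integral_tendsto.1 hβ F
  rw [integral_sub_eq_of_add_eq_add h (hint _) (hint _) (hint _) (hint _),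
    integral_restrict_of_tsupport_subset hs, integral_restrict_of_tsupport_subset hs]
  refine (h1.sub h2).congr fun k => ?_
  exact integral_posPartMeasure_sub (hg k) hf.aestronglyMeasurable hC

/-- Local uniformity of the convergence of primitives near a non-atom of the limit measures. -/
lemma exists_forall_abs_sub_lt_of_tendsto {G : ℕ → ℝ → ℝ}
    (hg : ∀ k, IntegrableOn (g k) (Ioo a b))
    (hGg : ∀ k, ∀ x ∈ Ioo a b, ∀ y ∈ Ioo a b, G k y - G k x = ∫ t in x..y, g k t)
    (hα : Tendsto (fun k => posPartFiniteMeasure (hg k)) atTop (𝓝 α))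
    (hβ : Tendsto (fun k => posPartFiniteMeasure (g := fun x => -g k x) (hg k).neg) atTop (𝓝 β))
    {x l ε : ℝ} (hx : x ∈ Ioo a b) (hxα : (α : Measure ℝ) {x} = 0) (hxβ : (β : Measure ℝ) {x} = 0)
    (hl : Tendsto (fun k => G k x) atTop (𝓝 l)) (hε : 0 < ε) :
    ∃ r > 0, Icc (x - r) (x + r) ⊆ Ioo a b ∧
      ∀ᶠ k in atTop, ∀ y ∈ Icc (x - r) (x + r), |G k y - l| < ε := by
  have hε3 : 0 < ENNReal.ofReal (ε / 2) := ENNReal.ofReal_pos.2 (by positivity)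
  obtain ⟨O₁, hO₁, hO₁o, hO₁α⟩ := Set.exists_isOpen_lt_of_lt {x} _ (hxα.trans_lt hε3)
  obtain ⟨O₂, hO₂, hO₂o, hO₂β⟩ := Set.exists_isOpen_lt_of_lt {x} _ (hxβ.trans_lt hε3)
  have hO : O₁ ∩ O₂ ∩ Ioo a b ∈ 𝓝 x := inter_mem (inter_mem
    (hO₁o.mem_nhds (singleton_subset_iff.1 hO₁)) (hO₂o.mem_nhds (singleton_subset_iff.1 hO₂)))
    (Ioo_mem_nhds hx.1 hx.2)
  obtain ⟨r, hr, hrO⟩ := Metric.nhds_basis_closedBall.mem_iff.1 hO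
  rw [Real.closedBall_eq_Icc] at hrO
  have hI : Icc (x - r) (x + r) ⊆ Ioo a b := hrO.trans inter_subset_right
  refine ⟨r, hr, hI, ?_⟩
  filter_upwards [
    eventually_measure_lt_of_isClosed hα isClosed_Icc
      ((measure_mono (hrO.trans (inter_subset_left.trans inter_subset_left))).trans_lt hO₁α),
    eventually_measure_lt_of_isClosed hβ isClosed_Icc
      ((measure_mono (hrO.trans (inter_subset_left.trans inter_subset_right))).trans_lt hO₂β),
    Metric.tendsto_nhds.1 hl (ε / 2) (by positivity)] with k h1 h2 h3 y hy
  rw [Real.dist_eq] at h3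
  rw [coe_posPartFiniteMeasure] at h1 h2
  have hxI : x ∈ Icc (x - r) (x + r) := ⟨by linarith, by linarith⟩
  have : IsFiniteMeasure (posPartMeasure (Ioo a b) (g k)) := isFiniteMeasure_posPartMeasure (hg k)
  have : IsFiniteMeasure (posPartMeasure (Ioo a b) fun x => -g k x) :=
    isFiniteMeasure_posPartMeasure (g := fun x => -g k x) (hg k).neg
  have key : ∀ p ∈ Icc (x - r) (x + r), ∀ q ∈ Icc (x - r) (x + r), p ≤ q →
      |∫ t in p..q, g k t| < ε / 2 := by
    intro p hp q hq hpq
    have hsub : Ioc p q ⊆ Icc (x - r) (x + r) := fun t ht => ⟨hp.1.trans ht.1.le, ht.2.trans hq.2⟩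
    have e := measureReal_posPartMeasure_sub (hg k) (s := Ioc p q) measurableSet_Ioc
    rw [inter_eq_left.2 (hsub.trans hI), ← intervalIntegral.integral_of_le hpq] at e
    have l1 : (posPartMeasure (Ioo a b) (g k)).real (Ioc p q) < ε / 2 :=
      ENNReal.toReal_lt_of_lt_ofReal ((measure_mono hsub).trans_lt h1)
    have l2 : (posPartMeasure (Ioo a b) fun x => -g k x).real (Ioc p q) < ε / 2 :=
      ENNReal.toReal_lt_of_lt_ofReal ((measure_mono hsub).trans_lt h2)
    have n1 : 0 ≤ (posPartMeasure (Ioo a b) (g k)).real (Ioc p q) := measureReal_nonneg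
    have n2 : 0 ≤ (posPartMeasure (Ioo a b) fun x => -g k x).real (Ioc p q) := measureReal_nonneg
    rw [← e, abs_lt]
    constructor <;> linarith
  have h4 : |G k y - G k x| < ε / 2 := by
    rcases le_total x y with hxy | hxy
    · rw [hGg k x (hI hxI) y (hI hy)]
      exact key x hxI y hy hxy
    · rw [abs_sub_comm, hGg k y (hI hy) x (hI hxI)]
      exact key y hy x hxI hxy
  calc |G k y - l| ≤ |G k y - G k x| + |G k x - l| := abs_sub_le _ _ _
    _ < ε := by linarith

lemma posPartMeasure_le_mul_volume {S J : Set ℝ} {f : ℝ → ℝ} {R : ℝ} (hR : ∀ y ∈ J, f y ≤ R)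
    {s : Set ℝ} (hsJ : s ⊆ J) (hs : MeasurableSet s) :
    posPartMeasure S f s ≤ ENNReal.ofReal R * volume s := by
  rw [posPartMeasure_apply hs]
  calc ∫⁻ x in s ∩ S, ENNReal.ofReal (f x) ≤ ∫⁻ x in s, ENNReal.ofReal (f x) :=
        lintegral_mono_set inter_subset_left
    _ ≤ ∫⁻ _ in s, ENNReal.ofReal R :=
        setLIntegral_mono measurable_const fun x hx => ENNReal.ofReal_le_ofReal (hR x (hsJ hx))
    _ = ENNReal.ofReal R * volume s := setLIntegral_const _ _

lemma measure_eq_zero_of_eventually_nonpos (hg : ∀ k, IntegrableOn (g k) (Ioo a b))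
    (hα : Tendsto (fun k => posPartFiniteMeasure (hg k)) atTop (𝓝 α)) {J : Set ℝ} (hJ : IsOpen J)
    (h : ∀ᶠ k in atTop, ∀ y ∈ J, g k y ≤ 0) : (α : Measure ℝ) J = 0 := by
  refine le_antisymm (measure_le_of_eventually_le_of_isOpen hα hJ ?_) zero_le
  filter_upwards [h] with k hk
  refine (posPartMeasure_le_mul_volume hk subset_rfl hJ.measurableSet).trans ?_
  simp

lemma measure_inter_eq_zero_of_eventually_le (hg : ∀ k, IntegrableOn (g k) (Ioo a b))
    (hα : Tendsto (fun k => posPartFiniteMeasure (hg k)) atTop (𝓝 α)) {J : Set ℝ} (hJ : IsOpen J)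
    {R : ℝ} (h : ∀ᶠ k in atTop, ∀ y ∈ J, g k y ≤ R) {A : Set ℝ} (hA : volume A = 0) :
    (α : Measure ℝ) (A ∩ J) = 0 := by
  refine measure_eq_zero_of_eventually_le_mul_volume hα hJ R.toNNReal ?_ hA
  filter_upwards [h] with k hk s hsJ hs
  exact posPartMeasure_le_mul_volume hk hsJ hs

lemma integral_mul_toReal_rnDeriv_eq {μ : Measure ℝ} [IsFiniteMeasure μ] {J : Set ℝ}
    (hJ : IsOpen J) (hac : ∀ A, volume A = 0 → μ (A ∩ J) = 0) {f : ℝ → ℝ} (hf : tsupport f ⊆ J) :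
    ∫ x, f x * (μ.rnDeriv volume x).toReal = ∫ x, f x ∂μ := by
  have hac' : μ.restrict J ≪ volume := fun A hA => by
    rw [Measure.restrict_apply' hJ.measurableSet]
    exact hac A hA
  rw [← integral_restrict_of_tsupport_subset hf μ, ← integral_rnDeriv_smul hac']
  refine integral_congr_ae ?_
  filter_upwards [Measure.rnDeriv_restrict μ volume hJ.measurableSet] with x hx
  rw [hx]
  by_cases hxJ : x ∈ J
  · simp [hxJ, mul_comm]
  · simp [eq_zero_of_tsupport_subset hf hxJ]

/-- Where the sequence is locally bounded, the limit measure is absolutely continuous and its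
density is the pointwise limit. -/
lemma ae_uaD_eq_of_eventually_abs_le (hg : ∀ k, IntegrableOn (g k) (Ioo a b))
    (hα : Tendsto (fun k => posPartFiniteMeasure (hg k)) atTop (𝓝 α))
    (hβ : Tendsto (fun k => posPartFiniteMeasure (g := fun x => -g k x) (hg k).neg) atTop (𝓝 β))
    {μp μn : Measure ℝ} [IsFiniteMeasure μp] [IsFiniteMeasure μn] (hs : μp ⟂ₘ μn)
    (h : μp + (β : Measure ℝ).restrict (Ioo a b) = μn + (α : Measure ℝ).restrict (Ioo a b))
    {V : ℝ → ℝ} (hV : ∀ᵐ x ∂(volume.restrict (Ioo a b)), Tendsto (fun k => g k x) atTop (𝓝 (V x)))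
    {J : Set ℝ} (hJ : IsOpen J) (hJab : J ⊆ Ioo a b) {R : ℝ}
    (hR : ∀ᶠ k in atTop, ∀ y ∈ J, |g k y| ≤ R) :
    (∀ A, volume A = 0 → μp (A ∩ J) = 0) ∧ (∀ A, volume A = 0 → μn (A ∩ J) = 0) ∧
      ∀ᵐ x, x ∈ J → uaD μp μn x = V x := by
  have hp : ∀ A, volume A = 0 → μp (A ∩ J) = 0 := fun A hA => le_antisymm
    (((le_of_mutuallySingular_add_eq_add hs h).trans Measure.restrict_le_self _).trans
      (measure_inter_eq_zero_of_eventually_le hg hα hJ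
        (hR.mono fun k hk y hy => (le_abs_self _).trans (hk y hy)) hA).le) zero_le
  have hn : ∀ A, volume A = 0 → μn (A ∩ J) = 0 := fun A hA => le_antisymm
    (((le_of_mutuallySingular_add_eq_add hs.symm h.symm).trans Measure.restrict_le_self _).trans
      (measure_inter_eq_zero_of_eventually_le (g := fun k x => -g k x) (fun k => (hg k).neg) hβ hJ
        (hR.mono fun k hk y hy => (neg_le_abs _).trans (hk y hy)) hA).le) zero_le
  refine ⟨hp, hn, ?_⟩
  have hVJ : ∀ᵐ x ∂(volume.restrict J), Tendsto (fun k => g k x) atTop (𝓝 (V x)) :=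
    ae_restrict_of_ae_restrict_of_subset hJab hV
  have hVm : AEStronglyMeasurable V (volume.restrict J) :=
    aestronglyMeasurable_of_tendsto_ae atTop
      (fun k => ((hg k).mono_set hJab).aestronglyMeasurable) hVJ
  have hvol : volume J ≠ ∞ := ((measure_mono hJab).trans_lt (by simp)).ne
  have hVb : ∀ᵐ x ∂(volume.restrict J), ‖V x‖ ≤ R := by
    filter_upwards [hVJ, ae_restrict_mem hJ.measurableSet] with x hx hxJ
    exact le_of_tendsto hx.abs (hR.mono fun k hk => hk x hxJ)
  have hVi : IntegrableOn V J := (integrableOn_const (C := R) hvol).mono' hVm hVb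
  have hui : Integrable (uaD μp μn) :=
    Measure.integrable_toReal_rnDeriv.sub Measure.integrable_toReal_rnDeriv
  have hloc : LocallyIntegrableOn (fun x => uaD μp μn x - V x) J :=
    (hui.integrableOn.sub hVi).locallyIntegrableOn
  have key := hJ.ae_eq_zero_of_integral_contDiff_smul_eq_zero hloc fun f hf hc hfs => by
    obtain ⟨C, hC⟩ := exists_abs_le_of_continuous_of_hasCompactSupport hf.continuous hc
    have i1 : ∀ μ : Measure ℝ, IsFiniteMeasure μ →
        Integrable fun x => f x * (μ.rnDeriv volume x).toReal := fun μ _ =>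
      Measure.integrable_toReal_rnDeriv.bdd_mul hf.continuous.aestronglyMeasurable
        (ae_of_all _ hC)
    have i2 : Integrable fun x => f x * uaD μp μn x :=
      hui.bdd_mul hf.continuous.aestronglyMeasurable (ae_of_all _ hC)
    have i3 : IntegrableOn (fun x => f x * V x) J :=
      hVi.bdd_mul hf.continuous.aestronglyMeasurable (ae_of_all _ hC)
    have e1 : ∫ x, f x * uaD μp μn x = (∫ x, f x ∂μp) - ∫ x, f x ∂μn := by
      simp_rw [uaD, mul_sub]
      rw [integral_sub (i1 μp inferInstance) (i1 μn inferInstance),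
        integral_mul_toReal_rnDeriv_eq hJ hp hfs, integral_mul_toReal_rnDeriv_eq hJ hn hfs]
    have t1 := tendsto_integral_mul_of_tendsto_posPart hg hα hβ h hf.continuous (hfs.trans hJab)
    have hres : ∀ q : ℝ → ℝ, ∀ S : Set ℝ, J ⊆ S → ∫ x in S, f x * q x = ∫ x, f x * q x :=
      fun q S hS => integral_restrict_of_tsupport_subset
        ((tsupport_mul_subset_left).trans (hfs.trans hS)) _
    have t2 : Tendsto (fun k => ∫ x in Ioo a b, f x * g k x) atTop (𝓝 (∫ x in J, f x * V x)) := by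
      simp_rw [hres _ _ hJab, ← hres _ J subset_rfl]
      refine tendsto_integral_filter_of_dominated_convergence (fun _ => C * R)
        (Eventually.of_forall fun k => hf.continuous.aestronglyMeasurable.mul
          ((hg k).mono_set hJab).aestronglyMeasurable) ?_ (integrableOn_const hvol) ?_
      · filter_upwards [hR] with k hk
        filter_upwards [ae_restrict_mem hJ.measurableSet] with x hx
        rw [norm_mul]
        exact mul_le_mul (hC x) (hk x hx) (abs_nonneg _) ((abs_nonneg _).trans (hC x))
      · filter_upwards [hVJ] with x hx
        exact hx.const_mul _
    have e2 := tendsto_nhds_unique t1 t2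
    simp only [smul_eq_mul]
    rw [← hres (fun x => uaD μp μn x - V x) J subset_rfl]
    simp_rw [mul_sub]
    rw [integral_sub i2.integrableOn i3, hres (uaD μp μn) J subset_rfl, e1, e2, sub_self]
  filter_upwards [key] with x hx hxJ
  exact sub_eq_zero.1 (hx hxJ)

end LocalLimits

section LocalUniformity

variable {ψ : ℝ → ℝ} {a b : ℝ} {v w : ℕ → ℝ → ℝ} {γ δ : FiniteMeasure ℝ}

lemma PsiHyp.exists_eventually_abs_le (hψ : PsiHyp ψ)
    (hq : ∀ k, IntegrableOn (fun x => ψ (v k x) * w k x) (Ioo a b))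
    (hPsi : ∀ k, ∀ x ∈ Ioo a b, ∀ y ∈ Ioo a b,
      Psi1 ψ (v k y) - Psi1 ψ (v k x) = ∫ t in x..y, ψ (v k t) * w k t)
    (hγ : Tendsto (fun k => posPartFiniteMeasure (hq k)) atTop (𝓝 γ))
    (hδ : Tendsto (fun k => posPartFiniteMeasure (g := fun x => -(ψ (v k x) * w k x)) (hq k).neg)
      atTop (𝓝 δ))
    {x l : ℝ} (hx : x ∈ Ioo a b) (hxγ : (γ : Measure ℝ) {x} = 0) (hxδ : (δ : Measure ℝ) {x} = 0)
    (hl : Tendsto (fun k => Psi1 ψ (v k x)) atTop (𝓝 l)) (h0 : 0 < l) (h1 : l < ∫ t, ψ t) :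
    ∃ R, ∃ r > 0, Icc (x - r) (x + r) ⊆ Ioo a b ∧
      ∀ᶠ k in atTop, ∀ y ∈ Icc (x - r) (x + r), |v k y| ≤ R := by
  obtain ⟨p, hp⟩ := hψ.exists_Psi1_eq (s := l / 2) (by linarith) (by linarith)
  obtain ⟨q, hq'⟩ := hψ.exists_Psi1_eq (s := (l + ∫ t, ψ t) / 2) (by linarith) (by linarith)
  obtain ⟨r, hr, hI, hev⟩ := exists_forall_abs_sub_lt_of_tendsto (G := fun k y => Psi1 ψ (v k y))
    hq hPsi hγ hδ hx hxγ hxδ hl (ε := min (l / 2) (((∫ t, ψ t) - l) / 2))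
    (lt_min (by linarith) (by linarith))
  refine ⟨max |p| |q|, r, hr, hI, hev.mono fun k hk y hy => ?_⟩
  obtain ⟨k1, k2⟩ := abs_lt.1 (hk y hy)
  have m1 := min_le_left (l / 2) (((∫ t, ψ t) - l) / 2)
  have m2 := min_le_right (l / 2) (((∫ t, ψ t) - l) / 2)
  have l1 : p < v k y := hψ.strictMono_Psi1.lt_iff_lt.1 (by rw [hp]; linarith)
  have l2 : v k y < q := hψ.strictMono_Psi1.lt_iff_lt.1 (by rw [hq']; linarith)
  exact abs_le_max_abs_abs l1.le l2.le

lemma PsiHyp.exists_eventually_ge (hψ : PsiHyp ψ)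
    (hq : ∀ k, IntegrableOn (fun x => ψ (v k x) * w k x) (Ioo a b))
    (hPsi : ∀ k, ∀ x ∈ Ioo a b, ∀ y ∈ Ioo a b,
      Psi1 ψ (v k y) - Psi1 ψ (v k x) = ∫ t in x..y, ψ (v k t) * w k t)
    (hγ : Tendsto (fun k => posPartFiniteMeasure (hq k)) atTop (𝓝 γ))
    (hδ : Tendsto (fun k => posPartFiniteMeasure (g := fun x => -(ψ (v k x) * w k x)) (hq k).neg)
      atTop (𝓝 δ))
    {x : ℝ} (hx : x ∈ Ioo a b) (hxγ : (γ : Measure ℝ) {x} = 0) (hxδ : (δ : Measure ℝ) {x} = 0)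
    (hl : Tendsto (fun k => Psi1 ψ (v k x)) atTop (𝓝 (∫ t, ψ t))) (R : ℝ) :
    ∃ r > 0, Icc (x - r) (x + r) ⊆ Ioo a b ∧
      ∀ᶠ k in atTop, ∀ y ∈ Icc (x - r) (x + r), R ≤ v k y := by
  obtain ⟨r, hr, hI, hev⟩ := exists_forall_abs_sub_lt_of_tendsto (G := fun k y => Psi1 ψ (v k y))
    hq hPsi hγ hδ hx hxγ hxδ hl (ε := (∫ t, ψ t) - Psi1 ψ R) (sub_pos.2 (hψ.Psi1_lt R))
  refine ⟨r, hr, hI, hev.mono fun k hk y hy => ?_⟩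
  obtain ⟨k1, -⟩ := abs_lt.1 (hk y hy)
  exact (hψ.strictMono_Psi1.lt_iff_lt.1 (by linarith)).le

lemma PsiHyp.exists_eventually_le (hψ : PsiHyp ψ)
    (hq : ∀ k, IntegrableOn (fun x => ψ (v k x) * w k x) (Ioo a b))
    (hPsi : ∀ k, ∀ x ∈ Ioo a b, ∀ y ∈ Ioo a b,
      Psi1 ψ (v k y) - Psi1 ψ (v k x) = ∫ t in x..y, ψ (v k t) * w k t)
    (hγ : Tendsto (fun k => posPartFiniteMeasure (hq k)) atTop (𝓝 γ))
    (hδ : Tendsto (fun k => posPartFiniteMeasure (g := fun x => -(ψ (v k x) * w k x)) (hq k).neg)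
      atTop (𝓝 δ))
    {x : ℝ} (hx : x ∈ Ioo a b) (hxγ : (γ : Measure ℝ) {x} = 0) (hxδ : (δ : Measure ℝ) {x} = 0)
    (hl : Tendsto (fun k => Psi1 ψ (v k x)) atTop (𝓝 0)) (R : ℝ) :
    ∃ r > 0, Icc (x - r) (x + r) ⊆ Ioo a b ∧
      ∀ᶠ k in atTop, ∀ y ∈ Icc (x - r) (x + r), v k y ≤ R := by
  obtain ⟨r, hr, hI, hev⟩ := exists_forall_abs_sub_lt_of_tendsto (G := fun k y => Psi1 ψ (v k y))
    hq hPsi hγ hδ hx hxγ hxδ hl (ε := Psi1 ψ R) (hψ.Psi1_pos R)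
  refine ⟨r, hr, hI, hev.mono fun k hk y hy => ?_⟩
  obtain ⟨-, k2⟩ := abs_lt.1 (hk y hy)
  exact (hψ.strictMono_Psi1.lt_iff_lt.1 (by linarith)).le

/-- If `Ψ₁ ∘ v k` converges almost everywhere and `v k` is bounded in `L¹`, then `v k` converges
almost everywhere to a finite limit. -/
lemma PsiHyp.exists_ae_tendsto (hψ : PsiHyp ψ) {C : ℝ}
    (hv : ∀ k, IntegrableOn (v k) (Ioo a b)) (hC : ∀ k, ∫ x in Ioo a b, |v k x| ≤ C) {z : ℝ → ℝ}
    (hz : ∀ᵐ x ∂(volume.restrict (Ioo a b)),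
      Tendsto (fun k => Psi1 ψ (v k x)) atTop (𝓝 (z x))) :
    ∃ V : ℝ → ℝ, ∀ᵐ x ∂(volume.restrict (Ioo a b)),
      Tendsto (fun k => v k x) atTop (𝓝 (V x)) ∧ Psi1 ψ (V x) = z x := by
  have hlint : ∀ k, ∫⁻ x in Ioo a b, ‖v k x‖ₑ ≤ ENNReal.ofReal C := by
    intro k
    rw [← ofReal_integral_norm_eq_lintegral_enorm (hv k)]
    exact ENNReal.ofReal_le_ofReal (hC k)
  have hm : ∀ k, AEMeasurable (fun x => ‖v k x‖ₑ) (volume.restrict (Ioo a b)) := fun k =>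
    (hv k).aestronglyMeasurable.enorm
  have hfatou : ∫⁻ x in Ioo a b, liminf (fun k => ‖v k x‖ₑ) atTop ≤ ENNReal.ofReal C :=
    (lintegral_liminf_le' fun k => hm k).trans
      (liminf_le_of_le (by isBoundedDefault) fun c hc => by
        obtain ⟨k, hk⟩ := hc.exists
        exact hk.trans (hlint k))
  have hml : AEMeasurable (fun x => liminf (fun k => ‖v k x‖ₑ) atTop)
      (volume.restrict (Ioo a b)) := by
    refine ⟨fun x => liminf (fun k => (hm k).mk _ x) atTop,
      Measurable.liminf fun k => (hm k).measurable_mk, ?_⟩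
    filter_upwards [ae_all_iff.2 fun k => (hm k).ae_eq_mk] with x hx
    simp only [hx]
  have hfin := ae_lt_top' hml
    (hfatou.trans_lt ENNReal.ofReal_lt_top).ne
  have hnot : ∀ s : ℕ → ℝ, liminf (fun k => ‖s k‖ₑ) atTop < ∞ →
      ¬ Tendsto (fun k => ‖s k‖) atTop atTop := by
    intro s hs hs'
    have : Tendsto (fun k => ‖s k‖ₑ) atTop (𝓝 ∞) := by
      simpa only [Function.comp_def, ofReal_norm] using
        ENNReal.tendsto_ofReal_atTop.comp hs'
    exact hs.ne this.liminf_eq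
  have hex : ∀ᵐ x ∂(volume.restrict (Ioo a b)), ∃ t, Psi1 ψ t = z x := by
    filter_upwards [hz, hfin] with x hx hxf
    have h0 : 0 ≤ z x := ge_of_tendsto' hx fun k => (hψ.Psi1_pos _).le
    have h1 : z x ≤ ∫ t, ψ t := le_of_tendsto' hx fun k => (hψ.Psi1_lt _).le
    refine hψ.exists_Psi1_eq (lt_of_le_of_ne h0 fun e => ?_) (lt_of_le_of_ne h1 fun e => ?_)
    · rw [← e] at hx
      exact hnot _ hxf (tendsto_abs_atBot_atTop.comp (hψ.tendsto_atBot_of_tendsto_Psi1 hx))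
    · rw [e] at hx
      exact hnot _ hxf (tendsto_norm_atTop_atTop.comp (hψ.tendsto_atTop_of_tendsto_Psi1 hx))
  classical
  refine ⟨fun x => if h : ∃ t, Psi1 ψ t = z x then h.choose else 0, ?_⟩
  filter_upwards [hz, hex] with x hx hxe
  simp only [hxe, dif_pos]
  refine ⟨hψ.tendsto_of_tendsto_Psi1 ?_, hxe.choose_spec⟩
  rwa [hxe.choose_spec]

lemma mem_ZPlus_of_forall_ae_ge {q : ℝ → ℝ} (hq : Integrable q) {x : ℝ} (hx : x ∈ Ioo a b)
    (h : ∀ R, ∃ r > 0, ∀ᵐ y ∂(volume.restrict (Icc (x - r) (x + r))), R ≤ q y) :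
    x ∈ ZPlus a b q := by
  refine ⟨hx, tendsto_atTop.2 fun R => ?_⟩
  obtain ⟨r, hr, hR⟩ := h R
  filter_upwards [Ioo_mem_nhdsGT hr] with ε hε
  have hsub : Ioo (x - ε) (x + ε) ⊆ Icc (x - r) (x + r) := fun t ht =>
    ⟨by linarith [ht.1, hε.2], by linarith [ht.2, hε.2]⟩
  rw [le_div_iff₀ (by linarith [hε.1])]
  calc R * (2 * ε) = ∫ _ in Ioo (x - ε) (x + ε), R := by
        rw [setIntegral_const, Real.volume_real_Ioo_of_le (by linarith [hε.1]), smul_eq_mul]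
        ring
    _ ≤ ∫ t in Ioo (x - ε) (x + ε), q t :=
        setIntegral_mono_ae_restrict (integrableOn_const (by simp)) hq.integrableOn
          (ae_restrict_of_ae_restrict_of_subset hsub hR)

lemma mem_ZMinus_of_forall_ae_le {q : ℝ → ℝ} (hq : Integrable q) {x : ℝ} (hx : x ∈ Ioo a b)
    (h : ∀ R, ∃ r > 0, ∀ᵐ y ∂(volume.restrict (Icc (x - r) (x + r))), q y ≤ R) :
    x ∈ ZMinus a b q := by
  have h1 : x ∈ ZPlus a b fun y => -q y := mem_ZPlus_of_forall_ae_ge hq.neg hx fun R => by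
    obtain ⟨r, hr, hR⟩ := h (-R)
    exact ⟨r, hr, hR.mono fun y hy => le_neg_of_le_neg hy⟩
  refine ⟨hx, (tendsto_neg_atTop_atBot.comp h1.2).congr fun ε => ?_⟩
  simp [integral_neg, neg_div]

/-- A criterion for the singular part without jumps to be concentrated on `Z`. -/
lemma singularPart_restrict_compl_eq_zero {μ : Measure ℝ} {Z S N : Set ℝ}
    (hμ : μ (Ioo a b)ᶜ = 0) (hS : S.Countable) (hN : N.Countable)
    (hat : ∀ y ∈ Ioo a b, y ∉ S → μ {y} = 0)
    (hloc : ∀ x ∈ Ioo a b, x ∉ N → x ∉ Z →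
      ∃ O, IsOpen O ∧ x ∈ O ∧ ∀ A, volume A = 0 → μ (A ∩ O) = 0) :
    (μ.singularPart volume).restrict Sᶜ Zᶜ = 0 := by
  have hle : μ.singularPart volume ≤ μ := Measure.singularPart_le _ _
  rw [Measure.restrict_apply' hS.measurableSet.compl]
  have hcov : Zᶜ ∩ Sᶜ ⊆ (Ioo a b)ᶜ ∪ (N ∩ (Ioo a b ∩ Sᶜ)) ∪ (Ioo a b ∩ Nᶜ ∩ Zᶜ) := by
    intro y hy
    by_cases h1 : y ∈ Ioo a b
    · by_cases h2 : y ∈ N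
      · exact Or.inl (Or.inr ⟨h2, h1, hy.2⟩)
      · exact Or.inr ⟨⟨h1, h2⟩, hy.1⟩
    · exact Or.inl (Or.inl h1)
  refine measure_mono_null hcov (measure_union_null (measure_union_null ?_ ?_) ?_)
  · exact le_antisymm ((hle _).trans hμ.le) zero_le
  · refine (measure_null_iff_singleton (hN.mono inter_subset_left)).2 fun y hy => ?_
    exact le_antisymm ((hle _).trans (hat y hy.2.1 hy.2.2).le) zero_le
  · refine measure_null_of_locally_null _ fun x hx => ?_
    obtain ⟨O, hO, hxO, hOA⟩ := hloc x hx.1.1 hx.1.2 hx.2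
    refine ⟨O, mem_nhdsWithin_of_mem_nhds (hO.mem_nhds hxO), ?_⟩
    obtain ⟨A, hA, hA1, hA2⟩ := Measure.mutuallySingular_singularPart μ volume
    refine measure_mono_null (t := A ∪ (Aᶜ ∩ O)) (fun y hy => ?_) (measure_union_null hA1 ?_)
    · by_cases h : y ∈ A
      · exact Or.inl h
      · exact Or.inr ⟨h, hy⟩
    · exact le_antisymm ((hle _).trans (hOA _ hA2).le) zero_le

lemma measure_singleton_eq_zero_of_mutuallySingular {μp μn α β : Measure ℝ} [IsFiniteMeasure α]
    [IsFiniteMeasure β] {y : ℝ} (hs : μp ⟂ₘ μn) (h : μp + β = μn + α)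
    (hy : α.real {y} = β.real {y}) : μp {y} = 0 ∧ μn {y} = 0 := by
  have h1 : α {y} = β {y} :=
    (ENNReal.toReal_eq_toReal_iff' (measure_ne_top _ _) (measure_ne_top _ _)).1 hy
  have h2 := congrArg (fun m : Measure ℝ => m {y}) h
  simp only [Measure.add_apply, h1] at h2
  have h3 : μp {y} = μn {y} := (ENNReal.add_left_inj (measure_ne_top β _)).1 h2
  obtain ⟨S, -, hSp, hSn⟩ := hs
  by_cases hyS : y ∈ S
  · have : μp {y} = 0 := measure_mono_null (singleton_subset_iff.2 hyS) hSp
    exact ⟨this, h3 ▸ this⟩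
  · have : μn {y} = 0 := measure_mono_null (singleton_subset_iff.2 hyS) hSn
    exact ⟨h3.trans this, this⟩

end LocalUniformity

section Compactness

variable {ψ : ℝ → ℝ} {a b : ℝ} {v w : ℕ → ℝ → ℝ} {α β γ δ : FiniteMeasure ℝ}

lemma PsiHyp.limit_density_and_cantor (hψ : PsiHyp ψ) {C c d : ℝ}
    (hv : ∀ k, IntegrableOn (v k) (Ioo a b)) (hC : ∀ k, ∫ x in Ioo a b, |v k x| ≤ C)
    (hq : ∀ k, IntegrableOn (fun x => ψ (v k x) * w k x) (Ioo a b))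
    (hPsi : ∀ k, ∀ x ∈ Ioo a b, ∀ y ∈ Ioo a b,
      Psi1 ψ (v k y) - Psi1 ψ (v k x) = ∫ t in x..y, ψ (v k t) * w k t)
    (hα : Tendsto (fun k => posPartFiniteMeasure (hv k)) atTop (𝓝 α))
    (hβ : Tendsto (fun k => posPartFiniteMeasure (g := fun x => -v k x) (hv k).neg) atTop (𝓝 β))
    (hγ : Tendsto (fun k => posPartFiniteMeasure (hq k)) atTop (𝓝 γ))
    (hδ : Tendsto (fun k => posPartFiniteMeasure (g := fun x => -(ψ (v k x) * w k x)) (hq k).neg)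
      atTop (𝓝 δ))
    (hz : ∀ x ∈ Ioo a b, (γ : Measure ℝ) {x} = 0 → (δ : Measure ℝ) {x} = 0 →
      Tendsto (fun k => Psi1 ψ (v k x)) atTop
        (𝓝 (c + (γ : Measure ℝ).real (Iic x) - (δ : Measure ℝ).real (Iic x))))
    {μp μn : Measure ℝ} [IsFiniteMeasure μp] [IsFiniteMeasure μn] (hs : μp ⟂ₘ μn)
    (h : μp + (β : Measure ℝ).restrict (Ioo a b) = μn + (α : Measure ℝ).restrict (Ioo a b)) :
    (∀ᵐ x ∂(volume.restrict (Ioo a b)), Tendsto (fun k => v k x) atTop (𝓝 (uaD μp μn x)) ∧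
      Psi1 ψ (uaD μp μn x) =
        c + (γ : Measure ℝ).real (Iic x) - (δ : Measure ℝ).real (Iic x)) ∧
    cantorPos a b (fun x => d + (α : Measure ℝ).real (Iic x) - (β : Measure ℝ).real (Iic x)) μp
      (ZPlus a b (uaD μp μn))ᶜ = 0 ∧
    cantorNeg a b (fun x => d + (α : Measure ℝ).real (Iic x) - (β : Measure ℝ).real (Iic x)) μn
      (ZMinus a b (uaD μp μn))ᶜ = 0 := by
  set z : ℝ → ℝ := fun x => c + (γ : Measure ℝ).real (Iic x) - (δ : Measure ℝ).real (Iic x)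
  set N : Set ℝ := {x | (γ : Measure ℝ) {x} ≠ 0} ∪ {x | (δ : Measure ℝ) {x} ≠ 0} with hN
  have hNc : N.Countable := (countable_setOf_measure_singleton_ne_zero _).union
    (countable_setOf_measure_singleton_ne_zero _)
  have hNγ : ∀ x ∉ N, (γ : Measure ℝ) {x} = 0 := fun x hx => by
    by_contra hcon
    exact hx (Or.inl hcon)
  have hNδ : ∀ x ∉ N, (δ : Measure ℝ) {x} = 0 := fun x hx => by
    by_contra hcon
    exact hx (Or.inr hcon)
  have hzN : ∀ x ∈ Ioo a b, x ∉ N → Tendsto (fun k => Psi1 ψ (v k x)) atTop (𝓝 (z x)) :=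
    fun x hx hxN => hz x hx (hNγ x hxN) (hNδ x hxN)
  have hIooN : ∀ᵐ x ∂(volume.restrict (Ioo a b)), x ∈ Ioo a b ∧ x ∉ N := by
    filter_upwards [ae_restrict_mem measurableSet_Ioo, hNc.ae_notMem _] with x h1 h2
    exact ⟨h1, h2⟩
  obtain ⟨V, hV⟩ := hψ.exists_ae_tendsto hv hC (hIooN.mono fun x hx => hzN x hx.1 hx.2)
  have hV1 := hV.mono fun x hx => hx.1
  -- local structure at the points where the limit of `Ψ₁ ∘ v k` is interior
  have hint : ∀ x ∈ Ioo a b, x ∉ N → 0 < z x → z x < ∫ t, ψ t → ∃ O, IsOpen O ∧ x ∈ O ∧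
      (∀ A, volume A = 0 → μp (A ∩ O) = 0) ∧ (∀ A, volume A = 0 → μn (A ∩ O) = 0) ∧
      ∀ᵐ y, y ∈ O → uaD μp μn y = V y := by
    intro x hx hxN h0 h1
    obtain ⟨R, r, hr, hI, hev⟩ := hψ.exists_eventually_abs_le hq hPsi hγ hδ hx (hNγ x hxN)
      (hNδ x hxN) (hzN x hx hxN) h0 h1
    exact ⟨Ioo (x - r) (x + r), isOpen_Ioo, ⟨by linarith, by linarith⟩,
      ae_uaD_eq_of_eventually_abs_le hv hα hβ hs h hV1 isOpen_Ioo (Ioo_subset_Icc_self.trans hI)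
        (hev.mono fun k hk y hy => hk y (Ioo_subset_Icc_self hy))⟩
  have hzmem : ∀ x ∈ Ioo a b, x ∉ N → 0 ≤ z x ∧ z x ≤ ∫ t, ψ t := fun x hx hxN =>
    ⟨ge_of_tendsto' (hzN x hx hxN) fun k => (hψ.Psi1_pos _).le,
      le_of_tendsto' (hzN x hx hxN) fun k => (hψ.Psi1_lt _).le⟩
  have huV : ∀ᵐ x ∂(volume.restrict (Ioo a b)), uaD μp μn x = V x := by
    set B : Set ℝ := {x | x ∈ Ioo a b ∧ x ∉ N ∧ 0 < z x ∧ z x < ∫ t, ψ t ∧ uaD μp μn x ≠ V x}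
    have hB : volume B = 0 := measure_null_of_locally_null _ fun x hx => by
      obtain ⟨O, hO, hxO, -, -, hOV⟩ := hint x hx.1 hx.2.1 hx.2.2.1 hx.2.2.2.1
      refine ⟨B ∩ O, inter_mem_nhdsWithin _ (hO.mem_nhds hxO), ?_⟩
      refine measure_mono_null (fun y hy => ?_) (ae_iff.1 hOV)
      exact fun hcon => hy.1.2.2.2.2 (hcon hy.2)
    filter_upwards [hIooN, hV, ae_restrict_of_ae (measure_eq_zero_iff_ae_notMem.1 hB)]
      with x hx hxV hxB
    by_contra hne
    exact hxB ⟨hx.1, hx.2, hxV.2 ▸ hψ.Psi1_pos _, hxV.2 ▸ hψ.Psi1_lt _, hne⟩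
  have hlim : ∀ᵐ x ∂(volume.restrict (Ioo a b)),
      Tendsto (fun k => v k x) atTop (𝓝 (uaD μp μn x)) ∧ Psi1 ψ (uaD μp μn x) = z x := by
    filter_upwards [hV, huV] with x h1 h2
    rwa [h2]
  have hui : Integrable (uaD μp μn) :=
    Measure.integrable_toReal_rnDeriv.sub Measure.integrable_toReal_rnDeriv
  have hZp : ∀ x ∈ Ioo a b, x ∉ N → z x = ∫ t, ψ t → x ∈ ZPlus a b (uaD μp μn) := by
    intro x hx hxN hzx
    refine mem_ZPlus_of_forall_ae_ge hui hx fun R => ?_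
    obtain ⟨r, hr, hI, hev⟩ := hψ.exists_eventually_ge hq hPsi hγ hδ hx (hNγ x hxN)
      (hNδ x hxN) (hzx ▸ hzN x hx hxN) R
    refine ⟨r, hr, ?_⟩
    filter_upwards [ae_restrict_of_ae_restrict_of_subset hI hlim,
      ae_restrict_mem measurableSet_Icc] with y hy hyI
    exact ge_of_tendsto hy.1 (hev.mono fun k hk => hk y hyI)
  have hZm : ∀ x ∈ Ioo a b, x ∉ N → z x = 0 → x ∈ ZMinus a b (uaD μp μn) := by
    intro x hx hxN hzx
    refine mem_ZMinus_of_forall_ae_le hui hx fun R => ?_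
    obtain ⟨r, hr, hI, hev⟩ := hψ.exists_eventually_le hq hPsi hγ hδ hx (hNγ x hxN)
      (hNδ x hxN) (hzx ▸ hzN x hx hxN) R
    refine ⟨r, hr, ?_⟩
    filter_upwards [ae_restrict_of_ae_restrict_of_subset hI hlim,
      ae_restrict_mem measurableSet_Icc] with y hy hyI
    exact le_of_tendsto hy.1 (hev.mono fun k hk => hk y hyI)
  have hμpα := le_of_mutuallySingular_add_eq_add hs h
  have hμnβ := le_of_mutuallySingular_add_eq_add hs.symm h.symm
  set U : ℝ → ℝ := fun x => d + (α : Measure ℝ).real (Iic x) - (β : Measure ℝ).real (Iic x) with hU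
  have hjc : (jumpSet a b U).Countable := by
    refine ((countable_setOf_measure_singleton_ne_zero (α : Measure ℝ)).union
      (countable_setOf_measure_singleton_ne_zero (β : Measure ℝ))).mono fun y hy => ?_
    by_contra hcon
    simp only [mem_union, mem_ofPred, not_or, not_not] at hcon
    exact (mem_jumpSet_iff_measureReal_singleton_ne.1 hy).2 (by simp [Measure.real, hcon])
  have hat : ∀ y ∈ Ioo a b, y ∉ jumpSet a b U → μp {y} = 0 ∧ μn {y} = 0 := by
    intro y hy hyj
    refine measure_singleton_eq_zero_of_mutuallySingular hs h ?_
    rw [measureReal_restrict_apply (measurableSet_singleton y),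
      measureReal_restrict_apply (measurableSet_singleton y),
      inter_eq_left.2 (singleton_subset_iff.2 hy)]
    by_contra hcon
    exact hyj (mem_jumpSet_iff_measureReal_singleton_ne.2 ⟨hy, hcon⟩)
  refine ⟨hlim, ?_, ?_⟩
  · refine singularPart_restrict_compl_eq_zero (le_antisymm ((hμpα _).trans (by simp)) zero_le)
      hjc hNc (fun y hy hyj => (hat y hy hyj).1) fun x hx hxN hxZ => ?_
    have h1 := lt_of_le_of_ne (hzmem x hx hxN).2 fun e => hxZ (hZp x hx hxN e)
    rcases (hzmem x hx hxN).1.eq_or_lt with h0 | h0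
    · obtain ⟨r, hr, hI, hev⟩ := hψ.exists_eventually_le hq hPsi hγ hδ hx (hNγ x hxN)
        (hNδ x hxN) (h0 ▸ hzN x hx hxN) 0
      have hα0 := measure_eq_zero_of_eventually_nonpos hv hα (J := Ioo (x - r) (x + r)) isOpen_Ioo
        (hev.mono fun k hk y hy => hk y (Ioo_subset_Icc_self hy))
      exact ⟨_, isOpen_Ioo, ⟨by linarith, by linarith⟩, fun A _ =>
        measure_mono_null inter_subset_right (le_antisymm
          ((hμpα.trans Measure.restrict_le_self _).trans hα0.le) zero_le)⟩
    · obtain ⟨O, hO, hxO, hOp, -⟩ := hint x hx hxN h0 h1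
      exact ⟨O, hO, hxO, hOp⟩
  · refine singularPart_restrict_compl_eq_zero (le_antisymm ((hμnβ _).trans (by simp)) zero_le)
      hjc hNc (fun y hy hyj => (hat y hy hyj).2) fun x hx hxN hxZ => ?_
    have h0 := lt_of_le_of_ne (hzmem x hx hxN).1 fun e => hxZ (hZm x hx hxN e.symm)
    rcases (hzmem x hx hxN).2.eq_or_lt with h1 | h1
    · obtain ⟨r, hr, hI, hev⟩ := hψ.exists_eventually_ge hq hPsi hγ hδ hx (hNγ x hxN)
        (hNδ x hxN) (h1 ▸ hzN x hx hxN) 0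
      have hβ0 := measure_eq_zero_of_eventually_nonpos (g := fun k x => -v k x)
        (fun k => (hv k).neg) hβ (J := Ioo (x - r) (x + r)) isOpen_Ioo
        (hev.mono fun k hk y hy => neg_nonpos.2 (hk y (Ioo_subset_Icc_self hy)))
      exact ⟨_, isOpen_Ioo, ⟨by linarith, by linarith⟩, fun A _ =>
        measure_mono_null inter_subset_right (le_antisymm
          ((hμnβ.trans Measure.restrict_le_self _).trans hβ0.le) zero_le)⟩
    · obtain ⟨O, hO, hxO, -, hOn, -⟩ := hint x hx hxN h0 h1
      exact ⟨O, hO, hxO, hOn⟩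

end Compactness

/-- compactness for energy bounded sequences, case `p = 1`. -/
theorem statement_1 (a b : ℝ) (hab : a < b) (ψ : ℝ → ℝ) (hψ : PsiHyp ψ)
    (u v w : ℕ → ℝ → ℝ)
    (hrep : ∀ k, W2pRep 1 a b (u k) (v k) (w k))
    (hL1 : ∃ C0 : ℝ, ∀ k, ∫ x in Set.Ioo a b, |u k x| ≤ C0)
    (hE : ∃ C : ℝ, ∀ k,
      (∫ x in Set.Ioo a b, |v k x|) + ∫ x in Set.Ioo a b, ψ (v k x) * |w k x| ≤ C) :
    ∃ φ : ℕ → ℕ, StrictMono φ ∧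
    ∃ (U : ℝ → ℝ) (μp μn : Measure ℝ), MemX1 ψ a b U μp μn ∧
      -- `u_k ⇀ U` weakly* in `BV(]a,b[)`: strong `L¹` convergence together with
      -- weak* convergence of the derivative measures
      Tendsto (fun k => ∫ x in Set.Ioo a b, |u (φ k) x - U x|) atTop (𝓝 0) ∧
      (∀ f : ℝ → ℝ, Continuous f → tsupport f ⊆ Set.Ioo a b →
        Tendsto (fun k => ∫ x in Set.Ioo a b, f x * v (φ k) x) atTop
          (𝓝 ((∫ x, f x ∂μp) - ∫ x, f x ∂μn))) ∧
      -- `Ψ₁ ∘ u_k' ⇀ Ψ₁ ∘ (U')ᵃ` weakly* in `BV(]a,b[)`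
      (∃ νp νn : Measure ℝ,
        IsDerivMeasures a b (fun x => Psi1 ψ (uaD μp μn x)) νp νn ∧
        Tendsto (fun k =>
            ∫ x in Set.Ioo a b, |Psi1 ψ (v (φ k) x) - Psi1 ψ (uaD μp μn x)|) atTop (𝓝 0) ∧
        ∀ f : ℝ → ℝ, Continuous f → tsupport f ⊆ Set.Ioo a b →
          Tendsto (fun k => ∫ x in Set.Ioo a b, f x * (ψ (v (φ k) x) * w (φ k) x)) atTop
            (𝓝 ((∫ x, f x ∂νp) - ∫ x, f x ∂νn))) ∧
      -- `u_k' → (U')ᵃ` pointwise `L¹`-a.e. in `]a,b[`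
      (∀ᵐ x ∂(MeasureTheory.volume.restrict (Set.Ioo a b)),
        Tendsto (fun k => v (φ k) x) atTop (𝓝 (uaD μp μn x))) := by
  obtain ⟨C₀, hC₀⟩ := hL1
  obtain ⟨C, hC⟩ := hE
  have hud := fun k => (hrep k).1
  have hvw := fun k => (hrep k).2.1
  have hu := fun k => (hrep k).2.2.1
  have hv := fun k => (hrep k).2.2.2.1
  have hw := fun k => (hrep k).2.2.2.2.1
  have hq : ∀ k, IntegrableOn (fun x => ψ (v k x) * w k x) (Ioo a b) := fun k =>
    hψ.integrableOn_comp_mul (continuousOn_of_sub_eq_integral (hw k) (hvw k)) (hw k)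
  have hPsi := fun k => hψ.Psi1_comp_sub (hw k) (hvw k)
  have huv : ∀ k, ∀ x ∈ Ioo a b, ∀ y ∈ Ioo a b, u k y - u k x = ∫ t in x..y, v k t := by
    intro k x hx y hy
    have hsub : uIcc x y ⊆ Ioo a b := ordConnected_Ioo.uIcc_subset hx hy
    exact (intervalIntegral.integral_eq_sub_of_hasDerivAt (fun t ht => hud k t (hsub ht))
      (((hv k).mono_set hsub).intervalIntegrable)).symm
  have hqa : ∀ k, ∫ x in Ioo a b, |ψ (v k x) * w k x| = ∫ x in Ioo a b, ψ (v k x) * |w k x| :=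
    fun k => by simp_rw [abs_mul, abs_of_pos (hψ.pos _)]
  have hvC : ∀ k, ∫ x in Ioo a b, |v k x| ≤ C := by
    intro k
    have : 0 ≤ ∫ x in Ioo a b, ψ (v k x) * |w k x| := setIntegral_nonneg measurableSet_Ioo
      fun x _ => mul_nonneg (hψ.pos _).le (abs_nonneg _)
    linarith [hC k]
  have hqC : ∀ k, ∫ x in Ioo a b, |ψ (v k x) * w k x| ≤ C := by
    intro k
    have : 0 ≤ ∫ x in Ioo a b, |v k x| := setIntegral_nonneg measurableSet_Ioo
      fun x _ => abs_nonneg _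
    rw [hqa]
    linarith [hC k]
  have hPb : ∀ t, |Psi1 ψ t| ≤ ∫ s, ψ s := fun t => by
    rw [abs_of_pos (hψ.Psi1_pos t)]
    exact (hψ.Psi1_lt t).le
  have hPi : ∀ k, IntegrableOn (fun x => Psi1 ψ (v k x)) (Ioo a b) := fun k =>
    (integrableOn_const (C := ∫ s, ψ s) (by simp)).mono'
      (hψ.continuous_Psi1.comp_aestronglyMeasurable (hv k).aestronglyMeasurable)
      (ae_of_all _ fun x => hPb _)
  have hPC : ∀ k, ∫ x in Ioo a b, |Psi1 ψ (v k x)| ≤ ∫ _ in Ioo a b, ∫ s, ψ s := fun k =>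
    setIntegral_mono (hPi k).abs (integrableOn_const (by simp)) fun x => hPb _
  obtain ⟨φ₁, hφ₁, α, β, d, hα, hβ, -, hL⟩ :=
    exists_subseq_tendsto_of_primitive hab hu hv huv hC₀ hvC
  obtain ⟨φ₂, hφ₂, γ, δ, c, hγ, hδ, hz, hLz⟩ :=
    exists_subseq_tendsto_of_primitive hab (fun k => hPi (φ₁ k)) (fun k => hq (φ₁ k))
      (fun k => hPsi (φ₁ k)) (fun k => hPC (φ₁ k)) (fun k => hqC (φ₁ k))
  have hα' : Tendsto (fun k => posPartFiniteMeasure (hv (φ₁ (φ₂ k)))) atTop (𝓝 α) :=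
    hα.comp hφ₂.tendsto_atTop
  have hβ' : Tendsto (fun k => posPartFiniteMeasure (g := fun x => -v (φ₁ (φ₂ k)) x)
      (hv (φ₁ (φ₂ k))).neg) atTop (𝓝 β) := hβ.comp hφ₂.tendsto_atTop
  obtain ⟨μp, μn, hμp, hμn, hμs, hμ⟩ := exists_mutuallySingular_add_eq_add
    ((α : Measure ℝ).restrict (Ioo a b)) ((β : Measure ℝ).restrict (Ioo a b))
  obtain ⟨νp, νn, hνp, hνn, hνs, hν⟩ := exists_mutuallySingular_add_eq_add
    ((γ : Measure ℝ).restrict (Ioo a b)) ((δ : Measure ℝ).restrict (Ioo a b))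
  obtain ⟨hlim, hcp, hcn⟩ := hψ.limit_density_and_cantor (d := d) (fun k => hv (φ₁ (φ₂ k)))
    (fun k => hvC (φ₁ (φ₂ k))) (fun k => hq (φ₁ (φ₂ k))) (fun k => hPsi (φ₁ (φ₂ k)))
    hα' hβ' hγ hδ hz hμs hμ
  have hνd : IsDerivMeasures a b (fun x => Psi1 ψ (uaD μp μn x)) νp νn :=
    isDerivMeasures_of_ae_eq_cdf (hlim.mono fun x hx => hx.2) hνs hν
  refine ⟨fun k => φ₁ (φ₂ k), hφ₁.comp hφ₂, _, μp, μn,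
    ⟨isDerivMeasures_of_ae_eq_cdf (ae_of_all _ fun x => rfl) hμs hμ, ⟨νp, νn, hνd⟩, hcp, hcn⟩,
    hL.comp hφ₂.tendsto_atTop, fun f hf hfs =>
      tendsto_integral_mul_of_tendsto_posPart (fun k => hv (φ₁ (φ₂ k))) hα' hβ' hμ hf hfs,
    ⟨νp, νn, hνd, ?_, fun f hf hfs =>
      tendsto_integral_mul_of_tendsto_posPart (fun k => hq (φ₁ (φ₂ k))) hγ hδ hν hf hfs⟩,
    hlim.mono fun x hx => hx.1⟩
  refine hLz.congr fun k => integral_congr_ae ?_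
  filter_upwards [hlim] with x hx
  rw [hx.2]
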